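/- Let R = F_q[L_n, Q_{n,1}, …, Q_{n,n−1}] ⊆ S(V). Then (S(V)⊗Λ(V))^{SL_n(q)} = R ⊕ ⨁_{j=1}^{n} ⨁_{0 ≤ b_1 < ⋯ < b_j ≤ n−1} M_{n;b_1,…,b_j} · R, a direct sum of R-submodules; equivalently, (S(V)⊗Λ(V))^{SL_n(q)} is a free R-module with basis consisting of 1 together with the elements M_{n;b_1,…,b_j} for 1 ≤ j ≤ n and 0 ≤ b_1 < ⋯ < b_j ≤ n−1. In particular S(V)^{SL_n(q)} = F_q[L_n, Q_{n,1}, …, Q_{n,n−1}]. -/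

import Mathlib

open scoped TensorProduct
open MvPolynomial Finset

noncomputable section

/-- The symmetric algebra `S(V) = F[x_1,…,x_n]` of the natural module `V = F^n`. -/
abbrev SV (F : Type) [Field F] (n : ℕ) := MvPolynomial (Fin n) F

/-- The exterior algebra `Λ(V) = E[y_1,…,y_n]`. -/
abbrev LV (F : Type) [Field F] (n : ℕ) := ExteriorAlgebra F (Fin n → F)

/-- `S(V) ⊗ Λ(V)`. -/
abbrev SL (F : Type) [Field F] (n : ℕ) := SV F n ⊗[F] LV F n

/-- the variable `x_{a+1}` (0-indexed `a`), junk value `0` out of range. -/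
def xV (F : Type) [Field F] (n a : ℕ) : SV F n :=
  if h : a < n then X ⟨a, h⟩ else 0

/-- the exterior generator `y_{a+1}` (0-indexed `a`). -/
def yV (F : Type) [Field F] (n a : ℕ) : LV F n :=
  if h : a < n then ExteriorAlgebra.ι F (Pi.single (⟨a, h⟩ : Fin n) (1 : F)) else 0

/-- the product `y_{s_1} ⋯ y_{s_j}` over `S = {s_1 < ⋯ < s_j}` in increasing order. -/
def yProd (F : Type) [Field F] (n : ℕ) (S : Finset ℕ) : LV F n :=
  ((S.sort (· ≤ ·)).map (yV F n)).prod

/-- determinant of the matrix `(x_t^{q^c})` with rows indexed by `c ∈ R` in increasing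
order and columns by `t ∈ C` in increasing order; junk value `0` if sizes differ. -/
def subDet (F : Type) [Field F] (q n : ℕ) (R C : Finset ℕ) : SV F n :=
  if h : C.card = R.card then
    Matrix.det (Matrix.of fun i j : Fin R.card =>
      xV F n (C.orderEmbOfFin h j) ^ q ^ (R.orderEmbOfFin rfl i : ℕ))
  else 0

/-- Mui's element `M_{m;b_1,…,b_j}` where `B = {b_1 < ⋯ < b_j}` (0-indexed `b`'s);
for `B = ∅` this is the Moore determinant `det (x_t^{q^c})`. -/
def MuiM (F : Type) [Field F] (q n m : ℕ) (B : Finset ℕ) : SL F n :=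
  ∑ S ∈ (range m).powersetCard B.card,
    ((-1 : F) ^ (B.card * (B.card + 1) / 2 + (∑ s ∈ S, s) + B.card)) •
      (subDet F q n (range m \ B) (range m \ S) ⊗ₜ[F] yProd F n S)

/-- `∏_{c : F^a} (c_1 x_1 + ⋯ + c_a x_a + x_{t+1})` (0-indexed `t`). -/
def linProd (F : Type) [Field F] [Fintype F] (n a t : ℕ) : SV F n :=
  ∏ c : Fin a → F, ((∑ k : Fin a, MvPolynomial.C (c k) * xV F n k) + xV F n t)

/-- Dickson's `L_m = V_1 V_2 ⋯ V_m`. -/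
def Lm (F : Type) [Field F] [Fintype F] (n m : ℕ) : SV F n :=
  ∏ a ∈ range m, linProd F n a a

/-- The property characterizing the Dickson invariants `Q_{m,k}`:
`Q_{m,k} · L_m = L_{m,k}` in `F[x_1,…,x_m]`. -/
def DicksonProp (F : Type) [Field F] [Fintype F] (q : ℕ)
    (Q : (m : ℕ) → ℕ → SV F m) : Prop :=
  ∀ m k : ℕ, k ≤ m →
    Q m k * Lm F m m = subDet F q m (range (m + 1) \ {k}) (range m)

/-- action of a matrix on `S(V)` by linear substitution: `x_j ↦ ∑_i g_{ij} x_i`. -/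
def gAct (F : Type) [Field F] (n : ℕ) (g : Matrix (Fin n) (Fin n) F) :
    SV F n →ₐ[F] SV F n :=
  MvPolynomial.aeval fun j => ∑ i, MvPolynomial.C (g i j) * MvPolynomial.X i

/-- action of a matrix on `Λ(V)` by linear substitution: `y_j ↦ ∑_i g_{ij} y_i`. -/
def eAct (F : Type) [Field F] (n : ℕ) (g : Matrix (Fin n) (Fin n) F) :
    LV F n →ₐ[F] LV F n :=
  ExteriorAlgebra.map g.mulVecLin

/-- diagonal action of a matrix on `S(V) ⊗ Λ(V)`. -/
def tAct (F : Type) [Field F] (n : ℕ) (g : Matrix (Fin n) (Fin n) F) :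
    SL F n →ₐ[F] SL F n :=
  Algebra.TensorProduct.map (gAct F n g) (eAct F n g)

/-- the invariants of a set of matrices on `S(V) ⊗ Λ(V)`, as an `F`-subspace. -/
def invSL (F : Type) [Field F] (n : ℕ) (P : Set (Matrix (Fin n) (Fin n) F)) :
    Submodule F (SL F n) where
  carrier := {f | ∀ g ∈ P, tAct F n g f = f}
  add_mem' := fun ha hb g hg => by rw [map_add, ha g hg, hb g hg]
  zero_mem' := fun g hg => map_zero _
  smul_mem' := fun c f hf g hg => by rw [map_smul, hf g hg]

/-- the invariants of `S(V) ⊗ Λ(V) ⊗ Det^k`, i.e. elements with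
`det(g)^k (g·f) = f` for all `g ∈ P`. -/
def invSLtw (F : Type) [Field F] (n k : ℕ) (P : Set (Matrix (Fin n) (Fin n) F)) :
    Submodule F (SL F n) where
  carrier := {f | ∀ g ∈ P, g.det ^ k • tAct F n g f = f}
  add_mem' := fun ha hb g hg => by rw [map_add, smul_add, ha g hg, hb g hg]
  zero_mem' := fun g hg => by rw [map_zero, smul_zero]
  smul_mem' := fun c f hf g hg => by rw [map_smul, smul_comm, hf g hg]

/-- the invariants of a set of matrices on `S(V)`, as an `F`-subalgebra. -/
def invS (F : Type) [Field F] (n : ℕ) (P : Set (Matrix (Fin n) (Fin n) F)) :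
    Subalgebra F (SV F n) where
  carrier := {f | ∀ g ∈ P, gAct F n g f = f}
  mul_mem' := fun ha hb g hg => by rw [map_mul, ha g hg, hb g hg]
  one_mem' := fun g hg => map_one _
  add_mem' := fun ha hb g hg => by rw [map_add, ha g hg, hb g hg]
  zero_mem' := fun g hg => map_zero _
  algebraMap_mem' := fun c g hg => (gAct F n g).commutes c

/-- `v_{i,j+1}` (0-indexed `j`) for the composition `I`. -/
def vij (F : Type) [Field F] [Fintype F] (n : ℕ) (I : Composition n)
    (i : Fin I.length) (j : ℕ) : SV F n :=
  linProd F n (I.sizeUpTo i) (I.sizeUpTo i + j)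

/-- `θ_i = L_{n_i}(v_{i,1},…,v_{i,n_i})`. -/
def theta (F : Type) [Field F] [Fintype F] (n : ℕ) (I : Composition n)
    (i : Fin I.length) : SV F n :=
  MvPolynomial.aeval (fun t : Fin (I.blocksFun i) => vij F n I i t)
    (Lm F (I.blocksFun i) (I.blocksFun i))

/-- `q_{i,k} = Q_{n_i,k}(v_{i,1},…,v_{i,n_i})`, given the Dickson polynomials `Q`. -/
def qInv (F : Type) [Field F] [Fintype F] (n : ℕ) (Q : (m : ℕ) → ℕ → SV F m)
    (I : Composition n) (i : Fin I.length) (k : ℕ) : SV F n :=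
  MvPolynomial.aeval (fun t : Fin (I.blocksFun i) => vij F n I i t)
    (Q (I.blocksFun i) k)

/-- the index of the block (0-indexed) of the composition `I` containing `a`. -/
def blkIdx (n : ℕ) (I : Composition n) (a : ℕ) : ℕ :=
  ((range I.length).filter fun i => I.sizeUpTo (i + 1) ≤ a).card

/-- the parabolic subgroup `P_I`: invertible block upper-triangular matrices. -/
def PIset (F : Type) [Field F] (n : ℕ) (I : Composition n) :
    Set (Matrix (Fin n) (Fin n) F) :=
  {g | IsUnit g.det ∧ ∀ a b : Fin n, blkIdx n I b < blkIdx n I a → g a b = 0}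

/-- the subgroup `K_I ≤ P_I`: block upper-triangular with all diagonal blocks
of determinant `1`. -/
def KIset (F : Type) [Field F] (n : ℕ) (I : Composition n) :
    Set (Matrix (Fin n) (Fin n) F) :=
  {g | IsUnit g.det ∧ (∀ a b : Fin n, blkIdx n I b < blkIdx n I a → g a b = 0) ∧
    ∀ i : Fin I.length,
      Matrix.det (Matrix.of fun a b : Fin (I.blocksFun i) =>
        g (I.embedding i a) (I.embedding i b)) = 1}

/-- the unipotent subgroup `U_n` of uni-uppertriangular matrices. -/
def Uset (F : Type) [Field F] (n : ℕ) : Set (Matrix (Fin n) (Fin n) F) :=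
  {g | (∀ a b : Fin n, b < a → g a b = 0) ∧ ∀ a : Fin n, g a a = 1}

/-- `SL_n(q)`. -/
def SLset (F : Type) [Field F] (n : ℕ) : Set (Matrix (Fin n) (Fin n) F) :=
  {g | g.det = 1}

/-- `GL_n(q)`. -/
def GLset (F : Type) [Field F] (n : ℕ) : Set (Matrix (Fin n) (Fin n) F) :=
  {g | IsUnit g.det}

/-- the bigraded piece `S^i(V) ⊗ Λ^j(V)` of `S(V) ⊗ Λ(V)`. -/
def piece (F : Type) [Field F] (n i j : ℕ) : Submodule F (SL F n) :=
  LinearMap.range (TensorProduct.map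
    (MvPolynomial.homogeneousSubmodule (Fin n) F i).subtype
    (LinearMap.range (ExteriorAlgebra.ι F (M := Fin n → F)) ^ j).subtype)

/-- the Hilbert series in `ℤ[s][[t]]` of a bigraded subspace `W` of `S(V) ⊗ Λ(V)`:
the coefficient of `t^i` is `∑_{j=0}^n dim (W ∩ (S^i ⊗ Λ^j)) s^j`. -/
def Hser (F : Type) [Field F] (n : ℕ) (W : Submodule F (SL F n)) :
    PowerSeries (Polynomial ℤ) :=
  PowerSeries.mk fun i => ∑ j ∈ range (n + 1),
    Polynomial.C (Module.finrank F ↥(W ⊓ piece F n i j) : ℤ) * Polynomial.X ^ j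

/-- the Hilbert series in `ℤ[[t]]` of a graded subalgebra of `S(V)`. -/
def HserS (F : Type) [Field F] (n : ℕ) (W : Subalgebra F (SV F n)) :
    PowerSeries ℤ :=
  PowerSeries.mk fun d =>
    (Module.finrank F ↥(Subalgebra.toSubmodule W ⊓ MvPolynomial.homogeneousSubmodule (Fin n) F d) : ℤ)

/-- the index set for Mui-type basis elements attached to the composition `I`:
pairs `(i, B)` with `B = {b_1 < ⋯ < b_j} ⊆ {0,…,m_{i+1}−1}` nonempty and
`max B ≥ m_i` (0-indexed `i`). -/
def Adm (n : ℕ) (I : Composition n) : Finset (Fin I.length × Finset ℕ) :=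
  (Finset.univ ×ˢ (range n).powerset).filter fun x =>
    x.2 ⊆ range (I.sizeUpTo ((x.1 : ℕ) + 1)) ∧ x.2.Nonempty ∧ ∃ b ∈ x.2, I.sizeUpTo (x.1 : ℕ) ≤ b

section ExteriorProducts

variable {F : Type} [Field F] {n : ℕ}

theorem yV_mul_self (a : ℕ) : yV F n a * yV F n a = 0 := by
  unfold yV
  split_ifs
  · exact ExteriorAlgebra.ι_sq_zero _
  · simp

theorem yV_mul_swap (a b : ℕ) : yV F n a * yV F n b = -(yV F n b * yV F n a) := by
  unfold yV
  split_ifs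
  · exact eq_neg_of_add_eq_zero_left (ExteriorAlgebra.ι_add_mul_swap _ _)
  all_goals simp

theorem yProd_empty : yProd F n ∅ = 1 := by simp [yProd]

theorem yProd_insert_of_lt {a : ℕ} {T : Finset ℕ} (h : ∀ t ∈ T, a < t) :
    yProd F n (insert a T) = yV F n a * yProd F n T := by
  unfold yProd
  rw [Finset.sort_insert _ (fun b hb => (h b hb).le) (fun ha => lt_irrefl _ (h a ha))]
  simp

theorem yProd_singleton (a : ℕ) : yProd F n {a} = yV F n a := by
  simp [yProd]

theorem yV_mul_yProd_of_mem {a : ℕ} {T : Finset ℕ} (ha : a ∈ T) :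
    yV F n a * yProd F n T = 0 := by
  induction T using Finset.induction_on_min with
  | empty => simp at ha
  | insert m T hm ih =>
    rw [yProd_insert_of_lt hm, ← mul_assoc]
    rcases Finset.mem_insert.1 ha with rfl | ha
    · rw [yV_mul_self, zero_mul]
    · rw [yV_mul_swap, neg_mul, mul_assoc, ih ha, mul_zero, neg_zero]

theorem yV_mul_yProd_of_notMem {a : ℕ} {T : Finset ℕ} (ha : a ∉ T) :
    yV F n a * yProd F n T = (-1 : F) ^ #{t ∈ T | t < a} • yProd F n (insert a T) := by
  induction T using Finset.induction_on_min with
  | empty => simp [yProd_empty, yProd_singleton]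
  | insert m T hm ih =>
    have hmT : m ∉ T := fun h => lt_irrefl _ (hm m h)
    rw [Finset.mem_insert, not_or] at ha
    rcases lt_or_gt_of_ne ha.1 with h | h
    · have hlt : ∀ t ∈ insert m T, a < t := by
        intro t ht
        rcases Finset.mem_insert.1 ht with rfl | ht
        · exact h
        · exact h.trans (hm t ht)
      rw [yProd_insert_of_lt hlt, Finset.filter_false_of_mem (fun t ht => (hlt t ht).not_gt)]
      simp
    · rw [yProd_insert_of_lt hm, ← mul_assoc, yV_mul_swap, neg_mul, mul_assoc, ih ha.2,
        Finset.filter_insert, if_pos h, Finset.card_insert_of_notMem (by simp [hmT]),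
        Finset.insert_comm, yProd_insert_of_lt (a := m) (T := insert a T), pow_succ]
      · simp
      · intro t ht
        rcases Finset.mem_insert.1 ht with rfl | ht
        · exact h
        · exact hm t ht

theorem yProd_mul_yProd_of_not_disjoint {S U : Finset ℕ} (h : ¬ Disjoint S U) :
    yProd F n S * yProd F n U = 0 := by
  obtain ⟨a, haS, haU⟩ := Finset.not_disjoint_iff.1 h
  clear h
  induction S using Finset.induction_on_min with
  | empty => simp at haS
  | insert m S hm ih =>
    rw [yProd_insert_of_lt hm, mul_assoc]
    by_cases haS' : a ∈ S
    · rw [ih haS', mul_zero]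
    · obtain rfl : a = m := (Finset.mem_insert.1 haS).resolve_right haS'
      clear ih haS
      induction S using Finset.induction_on_min with
      | empty => rw [yProd_empty, one_mul, yV_mul_yProd_of_mem haU]
      | insert k S hk ih =>
        rw [yProd_insert_of_lt hk, ← mul_assoc, ← mul_assoc, yV_mul_swap, neg_mul, neg_mul,
          mul_assoc, mul_assoc, ih (fun hx => haS' (Finset.mem_insert_of_mem hx))
          (fun x hx => hm x (Finset.mem_insert_of_mem hx)), mul_zero, neg_zero]

theorem yProd_mul_yProd {S U : Finset ℕ} (h : Disjoint S U) :
    yProd F n S * yProd F n U =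
      (-1 : F) ^ (∑ s ∈ S, #{u ∈ U | u < s}) • yProd F n (S ∪ U) := by
  induction S using Finset.induction_on_min with
  | empty => simp [yProd_empty]
  | insert m S hm ih =>
    have hmS : m ∉ S := fun h => lt_irrefl _ (hm m h)
    rw [Finset.disjoint_insert_left] at h
    rw [yProd_insert_of_lt hm, mul_assoc, ih h.2, mul_smul_comm,
      yV_mul_yProd_of_notMem (by simp [hmS, h.1]), smul_smul, ← pow_add,
      Finset.sum_insert hmS, Finset.insert_union, Finset.filter_union,
      Finset.filter_false_of_mem (s := S) (fun t ht => (hm t ht).not_gt), Finset.empty_union,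
      add_comm]

theorem sum_card_filter_lt_self (S : Finset ℕ) :
    ∑ s ∈ S, #{u ∈ S | u < s} = (#S).choose 2 := by
  induction S using Finset.induction_on_max with
  | empty => simp
  | insert m S hm ih =>
    have hmS : m ∉ S := fun h => lt_irrefl _ (hm m h)
    rw [Finset.sum_insert hmS, Finset.card_insert_of_notMem hmS, Nat.choose_succ_succ' _ 1, ← ih,
      Finset.filter_insert, if_neg (lt_irrefl m), Finset.filter_true_of_mem hm, Nat.choose_one_right]
    congr 1
    refine Finset.sum_congr rfl fun s hs => ?_
    rw [Finset.filter_insert, if_neg (hm s hs).not_gt]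

theorem sum_card_compl_filter_lt {S : Finset ℕ} (hS : S ⊆ range n) :
    ∑ s ∈ S, #{u ∈ range n \ S | u < s} + (#S).choose 2 = ∑ s ∈ S, s := by
  rw [← sum_card_filter_lt_self, ← Finset.sum_add_distrib]
  refine Finset.sum_congr rfl fun s hs => ?_
  rw [← Finset.card_union_of_disjoint
    (Finset.disjoint_filter_filter Finset.sdiff_disjoint), ← Finset.filter_union,
    Finset.sdiff_union_of_subset hS]
  have : {u ∈ range n | u < s} = range s := by
    ext u
    have := Finset.mem_range.1 (hS hs)
    simp only [Finset.mem_filter, Finset.mem_range]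
    omega
  rw [this, Finset.card_range]

theorem yProd_mul_yProd_compl {S : Finset ℕ} (hS : S ⊆ range n) :
    yProd F n S * yProd F n (range n \ S) =
      (-1 : F) ^ ((#S).choose 2 + ∑ s ∈ S, s) • yProd F n (range n) := by
  rw [yProd_mul_yProd Finset.disjoint_sdiff, Finset.union_sdiff_of_subset hS,
    ← sum_card_compl_filter_lt hS, add_comm, add_assoc, ← two_mul, pow_add, pow_mul]
  simp

end ExteriorProducts

section Coordinates

variable {F : Type} [Field F] {n : ℕ}

theorem basis_exteriorAlgebra_eq_yProd (T : Finset (Fin n)) :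
    (Pi.basisFun F (Fin n)).ExteriorAlgebra T = yProd F n (T.map Fin.valEmbedding) := by
  rw [ExteriorAlgebra.basis_apply_ofCard _ rfl, ExteriorAlgebra.ιMulti_family,
    ExteriorAlgebra.ιMulti_apply, yProd,
    ← Finset.map_sort (Fin.valEmbedding (n := n)) T (· ≤ ·) (· ≤ ·) (fun _ _ _ _ => Iff.rfl),
    ← Finset.listMap_orderEmbOfFin_finRange T rfl, List.map_map, List.map_map,
    List.ofFn_eq_map]
  congr 1
  refine List.map_congr_left fun i _ => ?_
  simp [yV, Set.powersetCard.ofFinEmbEquiv_symm_apply]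

/-- The `S(V)`-basis of `S(V) ⊗ Λ(V)` formed by the products of the generators `y_t`. -/
def yBasis (F : Type) [Field F] (n : ℕ) : Module.Basis (Finset (Fin n)) (SV F n) (SL F n) :=
  Algebra.TensorProduct.basis (SV F n) (Pi.basisFun F (Fin n)).ExteriorAlgebra

theorem yBasis_apply (T : Finset (Fin n)) :
    yBasis F n T = 1 ⊗ₜ[F] yProd F n (T.map Fin.valEmbedding) := by
  rw [yBasis, Algebra.TensorProduct.basis_apply, basis_exteriorAlgebra_eq_yProd]

theorem sum_powerset_range {M : Type*} [AddCommMonoid M] (φ : Finset ℕ → M) :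
    ∑ T ∈ (range n).powerset, φ T = ∑ T : Finset (Fin n), φ (T.map Fin.valEmbedding) := by
  symm
  refine Finset.sum_nbij (fun T => T.map Fin.valEmbedding) ?_ ?_ ?_ (fun _ _ => rfl)
  · intro T _
    rw [Finset.mem_powerset]
    intro a ha
    obtain ⟨i, -, rfl⟩ := Finset.mem_map.1 ha
    exact Finset.mem_range.2 i.2
  · exact (Finset.map_injective _).injOn
  · intro T hT
    rw [Finset.mem_coe, Finset.mem_powerset] at hT
    exact ⟨T.attachFin fun a ha => Finset.mem_range.1 (hT ha), by simp,
      Finset.map_valEmbedding_attachFin _⟩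

theorem exists_eq_sum_smul_yProd (f : SL F n) : ∃ c : Finset ℕ → SV F n,
    f = ∑ T ∈ (range n).powerset, c T • (1 ⊗ₜ[F] yProd F n T : SL F n) := by
  refine ⟨fun T => (yBasis F n).repr f {i : Fin n | (i : ℕ) ∈ T}, ?_⟩
  rw [sum_powerset_range]
  conv_lhs => rw [← (yBasis F n).sum_repr f]
  refine Finset.sum_congr rfl fun T _ => ?_
  rw [yBasis_apply]
  congr 2
  ext i
  simp [← Fin.ext_iff]

theorem eq_zero_of_sum_smul_yProd_eq_zero {c : Finset ℕ → SV F n}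
    (h : ∑ T ∈ (range n).powerset, c T • (1 ⊗ₜ[F] yProd F n T : SL F n) = 0)
    {T : Finset ℕ} (hT : T ⊆ range n) : c T = 0 := by
  rw [sum_powerset_range] at h
  simp_rw [← yBasis_apply] at h
  have := Fintype.linearIndependent_iff.1 (yBasis F n).linearIndependent
    (fun T => c (T.map Fin.valEmbedding)) h
    (T.attachFin fun a ha => Finset.mem_range.1 (hT ha))
  rwa [Finset.map_valEmbedding_attachFin] at this

theorem eq_of_sum_smul_yProd_eq {c d : Finset ℕ → SV F n}
    (h : ∑ T ∈ (range n).powerset, c T • (1 ⊗ₜ[F] yProd F n T : SL F n) =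
      ∑ T ∈ (range n).powerset, d T • (1 ⊗ₜ[F] yProd F n T : SL F n))
    {T : Finset ℕ} (hT : T ⊆ range n) : c T = d T := by
  refine sub_eq_zero.1 (eq_zero_of_sum_smul_yProd_eq_zero (c := fun T => c T - d T) ?_ hT)
  refine add_eq_right.1 (Eq.trans ?_ h)
  rw [← Finset.sum_add_distrib]
  refine Finset.sum_congr rfl fun T _ => ?_
  rw [← add_smul, sub_add_cancel]

end Coordinates

section Substitution

theorem sum_mul_self_eq_zero {ι R : Type*} [Ring R] (s : Finset ι) (z : ι → R)
    (h0 : ∀ i, z i * z i = 0) (h : ∀ i j, z i * z j = -(z j * z i)) :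
    (∑ i ∈ s, z i) * ∑ i ∈ s, z i = 0 := by
  classical
  induction s using Finset.induction_on with
  | empty => simp
  | insert a s ha ih =>
    rw [Finset.sum_insert ha, add_mul, mul_add, mul_add, h0, ih, Finset.mul_sum, Finset.sum_mul,
      Finset.sum_congr rfl fun i _ => h a i, Finset.sum_neg_distrib]
    abel

variable {F : Type} [Field F] {n : ℕ}

/-- The `S(V)`-algebra endomorphism of `S(V) ⊗ Λ(V)` sending `y_t` to `∑_b w_{bt} y_b`. -/
def substY (w : ℕ → ℕ → SV F n) : SL F n →ₐ[SV F n] SL F n :=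
  Algebra.TensorProduct.lift (Algebra.ofId (SV F n) (SL F n))
    (ExteriorAlgebra.lift F ⟨Fintype.linearCombination F
      (fun t : Fin n => ∑ b ∈ range n, (w b t ⊗ₜ[F] yV F n b : SL F n)), fun v => by
        rw [Fintype.linearCombination_apply]
        simp_rw [Finset.smul_sum]
        rw [← Finset.sum_product']
        refine sum_mul_self_eq_zero _ _ (fun i => ?_) (fun i j => ?_)
        · rw [TensorProduct.smul_tmul', Algebra.TensorProduct.tmul_mul_tmul, yV_mul_self,
            TensorProduct.tmul_zero]
        · rw [TensorProduct.smul_tmul', TensorProduct.smul_tmul',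
            Algebra.TensorProduct.tmul_mul_tmul, Algebra.TensorProduct.tmul_mul_tmul, yV_mul_swap,
            TensorProduct.tmul_neg, mul_comm]⟩)
    (fun x y => by rw [Algebra.ofId_apply]; exact Algebra.commutes _ _)

theorem substY_yV (w : ℕ → ℕ → SV F n) {t : ℕ} (ht : t < n) :
    substY w (1 ⊗ₜ[F] yV F n t) = ∑ b ∈ range n, w b t ⊗ₜ[F] yV F n b := by
  rw [substY, Algebra.TensorProduct.lift_tmul, map_one, one_mul, yV, dif_pos ht,
    ExteriorAlgebra.lift_ι_apply]
  simp [Fintype.linearCombination_apply_single]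

/-- The minor of `w` with rows `B` and columns `T`, and `0` if their sizes differ. -/
def minorDet {A : Type*} [CommRing A] (w : ℕ → ℕ → A) (B T : Finset ℕ) : A :=
  if h : #T = #B then
    Matrix.det (Matrix.of fun i j : Fin #B => w (B.orderEmbOfFin rfl i) (T.orderEmbOfFin h j))
  else 0

theorem minorDet_eq {A : Type*} [CommRing A] (w : ℕ → ℕ → A) {B T : Finset ℕ} {k : ℕ}
    (hB : #B = k) (hT : #T = k) :
    minorDet w B T =
      Matrix.det (Matrix.of fun i j : Fin k => w (B.orderEmbOfFin hB i) (T.orderEmbOfFin hT j)) := by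
  subst hB
  rw [minorDet, dif_pos hT]

theorem minorDet_transpose {A : Type*} [CommRing A] (w : ℕ → ℕ → A) (B T : Finset ℕ) :
    minorDet (fun b t => w t b) T B = minorDet w B T := by
  by_cases h : #T = #B
  · rw [minorDet_eq w rfl h, minorDet_eq _ h rfl, ← Matrix.det_transpose]
    rfl
  · rw [minorDet, minorDet, dif_neg h, dif_neg (Ne.symm h)]

theorem sum_orderEmbOfFin {M : Type*} [AddCommMonoid M] {B : Finset ℕ} {k : ℕ} (hB : #B = k)
    (φ : ℕ → M) : ∑ b ∈ B, φ b = ∑ i, φ (B.orderEmbOfFin hB i) := by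
  refine Eq.trans (Finset.sum_congr ?_ fun _ _ => rfl)
    (Finset.sum_map Finset.univ (B.orderEmbOfFin hB).toEmbedding φ)
  simp

theorem card_filter_lt_orderEmbOfFin {B : Finset ℕ} {k : ℕ} (hB : #B = k) (i : Fin k) :
    #{b ∈ B | b < B.orderEmbOfFin hB i} = i := by
  have : {b ∈ B | b < B.orderEmbOfFin hB i} =
      (Finset.Iio i).map (B.orderEmbOfFin hB).toEmbedding := by
    ext b
    simp only [Finset.mem_filter, Finset.mem_map, Finset.mem_Iio]
    constructor
    · rintro ⟨hb, hlt⟩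
      rw [← Finset.mem_coe, ← Finset.range_orderEmbOfFin B hB] at hb
      obtain ⟨j, rfl⟩ := hb
      exact ⟨j, (B.orderEmbOfFin hB).lt_iff_lt.1 hlt, rfl⟩
    · rintro ⟨j, hj, rfl⟩
      exact ⟨Finset.orderEmbOfFin_mem _ _ _, (B.orderEmbOfFin hB).lt_iff_lt.2 hj⟩
  rw [this, Finset.card_map, Fin.card_Iio]

theorem orderEmbOfFin_erase {B : Finset ℕ} {k : ℕ} (hB : #B = k + 1) (i : Fin (k + 1))
    (h : #(B.erase (B.orderEmbOfFin hB i)) = k) (j : Fin k) :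
    (B.erase (B.orderEmbOfFin hB i)).orderEmbOfFin h j = B.orderEmbOfFin hB (i.succAbove j) := by
  refine (congrFun (Finset.orderEmbOfFin_unique h
    (f := fun j => B.orderEmbOfFin hB (i.succAbove j)) ?_ ?_) j).symm
  · intro j
    refine Finset.mem_erase.2 ⟨?_, Finset.orderEmbOfFin_mem _ _ _⟩
    exact (B.orderEmbOfFin hB).injective.ne (Fin.succAbove_ne i j)
  · exact (B.orderEmbOfFin hB).strictMono.comp (Fin.strictMono_succAbove i)

theorem orderEmbOfFin_insert_of_lt {T : Finset ℕ} {t k : ℕ} (ht : ∀ s ∈ T, t < s)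
    (hT : #T = k) (h : #(insert t T) = k + 1) (j : Fin (k + 1)) :
    (insert t T).orderEmbOfFin h j = Fin.cases t (T.orderEmbOfFin hT) j := by
  refine (congrFun (Finset.orderEmbOfFin_unique h
    (f := fun j => Fin.cases t (T.orderEmbOfFin hT) j) ?_ ?_) j).symm
  · intro j
    cases j using Fin.cases with
    | zero => simp
    | succ j => simp
  · intro i j hij
    cases j using Fin.cases with
    | zero => simp at hij
    | succ j =>
      cases i using Fin.cases with
      | zero => simpa using ht _ (Finset.orderEmbOfFin_mem _ _ _)
      | succ i => simpa using hij

theorem minorDet_insert {A : Type*} [CommRing A] (w : ℕ → ℕ → A) {B T : Finset ℕ} {t : ℕ}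
    (ht : ∀ s ∈ T, t < s) (h : #B = #T + 1) :
    minorDet w B (insert t T) =
      ∑ b ∈ B, (-1) ^ #{c ∈ B | c < b} * w b t * minorDet w (B.erase b) T := by
  have htT : t ∉ T := fun h => lt_irrefl _ (ht t h)
  have hT' : #(insert t T) = #T + 1 := Finset.card_insert_of_notMem htT
  rw [minorDet_eq w h hT', Matrix.det_succ_column_zero, sum_orderEmbOfFin h]
  refine Finset.sum_congr rfl fun i _ => ?_
  have hcard : #(B.erase (B.orderEmbOfFin h i)) = #T := by
    rw [Finset.card_erase_of_mem (Finset.orderEmbOfFin_mem _ _ _), h, Nat.add_sub_cancel]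
  rw [card_filter_lt_orderEmbOfFin, minorDet_eq w hcard rfl]
  congr 2
  · simp [orderEmbOfFin_insert_of_lt ht rfl]
  · ext a b
    simp [orderEmbOfFin_insert_of_lt ht rfl, orderEmbOfFin_erase]

theorem one_tmul_mul (a b : LV F n) :
    (1 ⊗ₜ[F] (a * b) : SL F n) = (1 ⊗ₜ[F] a) * (1 ⊗ₜ[F] b) := by
  rw [Algebra.TensorProduct.tmul_mul_tmul, one_mul]

theorem one_tmul_neg_one_pow_smul (k : ℕ) (a : LV F n) :
    (1 ⊗ₜ[F] ((-1 : F) ^ k • a) : SL F n) = (-1 : SV F n) ^ k • (1 ⊗ₜ[F] a) := by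
  rw [TensorProduct.tmul_smul, ← algebraMap_smul (SV F n), map_pow, map_neg, map_one]

theorem substY_yProd (w : ℕ → ℕ → SV F n) {T : Finset ℕ} (hT : T ⊆ range n) :
    substY w (1 ⊗ₜ[F] yProd F n T) =
      ∑ B ∈ (range n).powersetCard #T, minorDet w B T • (1 ⊗ₜ[F] yProd F n B) := by
  induction T using Finset.induction_on_min with
  | empty =>
    simp [yProd_empty, minorDet_eq w Finset.card_empty Finset.card_empty,
      ← Algebra.TensorProduct.one_def]
  | insert t T ht ih =>
    have htT : t ∉ T := fun h => lt_irrefl _ (ht t h)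
    rw [Finset.insert_subset_iff] at hT
    rw [yProd_insert_of_lt ht, one_tmul_mul, map_mul, substY_yV w (Finset.mem_range.1 hT.1),
      ih hT.2, Finset.sum_mul_sum, ← Finset.sum_product',
      Finset.card_insert_of_notMem htT]
    have hl : ∀ x ∈ range n ×ˢ (range n).powersetCard #T,
        (w x.1 t ⊗ₜ[F] yV F n x.1 : SL F n) * minorDet w x.2 T • (1 ⊗ₜ[F] yProd F n x.2) =
        if x.1 ∈ x.2 then 0 else
          (((-1) ^ #{c ∈ x.2 | c < x.1} * w x.1 t * minorDet w x.2 T) •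
            (1 ⊗ₜ[F] yProd F n (insert x.1 x.2))) := by
      rintro ⟨b, B⟩ -
      rw [mul_smul_comm, Algebra.TensorProduct.tmul_mul_tmul, mul_one]
      split_ifs with hb
      · rw [yV_mul_yProd_of_mem hb, TensorProduct.tmul_zero, smul_zero]
      · rw [yV_mul_yProd_of_notMem hb, ← mul_one (w b t), ← smul_eq_mul, ← TensorProduct.smul_tmul',
          one_tmul_neg_one_pow_smul, smul_smul, smul_smul]
        congr 1
        ring
    rw [Finset.sum_congr rfl hl, ← Finset.sum_filter_add_sum_filter_not _ (fun x => x.1 ∈ x.2)]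
    rw [Finset.sum_eq_zero (s := Finset.filter _ _), zero_add]
    swap
    · intro x hx
      rw [if_pos (Finset.mem_filter.1 hx).2]
    have hr : ∀ B ∈ (range n).powersetCard (#T + 1),
        minorDet w B (insert t T) • (1 ⊗ₜ[F] yProd F n B : SL F n) =
        ∑ b ∈ B, ((-1) ^ #{c ∈ B | c < b} * w b t * minorDet w (B.erase b) T) •
          (1 ⊗ₜ[F] yProd F n B) := by
      intro B hB
      rw [minorDet_insert w ht (Finset.mem_powersetCard.1 hB).2, Finset.sum_smul]
    rw [Finset.sum_congr rfl hr, Finset.sum_sigma']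
    refine Finset.sum_bij' (fun x _ => ⟨insert x.1 x.2, x.1⟩) (fun x _ => (x.2, x.1.erase x.2))
      ?_ ?_ ?_ ?_ ?_
    · rintro ⟨b, B⟩ hx
      simp only [Finset.mem_filter, Finset.mem_product, Finset.mem_powersetCard,
        Finset.mem_sigma] at hx ⊢
      exact ⟨⟨Finset.insert_subset hx.1.1 hx.1.2.1,
        by rw [Finset.card_insert_of_notMem hx.2, hx.1.2.2]⟩, Finset.mem_insert_self _ _⟩
    · rintro ⟨B, b⟩ hx
      simp only [Finset.mem_filter, Finset.mem_product, Finset.mem_powersetCard,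
        Finset.mem_sigma] at hx ⊢
      exact ⟨⟨hx.1.1 hx.2, (Finset.erase_subset _ _).trans hx.1.1,
        by rw [Finset.card_erase_of_mem hx.2, hx.1.2, Nat.add_sub_cancel]⟩,
        Finset.notMem_erase _ _⟩
    · rintro ⟨b, B⟩ hx
      simp only [Finset.mem_filter] at hx
      simp [Finset.erase_insert hx.2]
    · rintro ⟨B, b⟩ hx
      simp only [Finset.mem_sigma] at hx
      simp [Finset.insert_erase hx.2]
    · rintro ⟨b, B⟩ hx
      simp only [Finset.mem_filter] at hx
      simp [hx.2, Finset.erase_insert hx.2, Finset.filter_insert]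

end Substitution

section Laplace

variable {F : Type} [Field F] {n : ℕ}

theorem smul_yProd_cancel {c d : SV F n} {T : Finset ℕ} (hT : T ⊆ range n)
    (h : c • (1 ⊗ₜ[F] yProd F n T : SL F n) = d • (1 ⊗ₜ[F] yProd F n T)) : c = d := by
  have := eq_of_sum_smul_yProd_eq (F := F) (n := n) (c := fun U => if U = T then c else 0)
    (d := fun U => if U = T then d else 0) (T := T) ?_ hT
  · simpa using this
  · simpa [ite_smul, Finset.sum_ite_eq', hT] using h

theorem laplace_minorDet (w : ℕ → ℕ → SV F n) {B B' : Finset ℕ} (hB : B ⊆ range n)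
    (hB' : B' ⊆ range n) (hcard : #B' = #B) :
    ∑ S ∈ (range n).powersetCard #B, (-1) ^ (∑ s ∈ S, s) * minorDet w B' S *
      minorDet w (range n \ B) (range n \ S) =
    if B' = B then (-1) ^ (∑ s ∈ B, s) * minorDet w (range n) (range n) else 0 := by
  have key : (∑ S ∈ (range n).powersetCard #B, (-1) ^ ((#B).choose 2 + ∑ s ∈ S, s) *
      (minorDet w B' S * minorDet w (range n \ B) (range n \ S))) •
        (1 ⊗ₜ[F] yProd F n (range n) : SL F n) =
      (if B' = B then (-1) ^ ((#B).choose 2 + ∑ s ∈ B, s) * minorDet w (range n) (range n)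
        else 0) • (1 ⊗ₜ[F] yProd F n (range n)) := by
    have h1 := map_mul (substY fun b t => w t b) (1 ⊗ₜ[F] yProd F n B' : SL F n)
      (1 ⊗ₜ[F] yProd F n (range n \ B))
    rw [substY_yProd _ hB', substY_yProd _ Finset.sdiff_subset, Finset.sum_mul_sum] at h1
    simp_rw [minorDet_transpose] at h1
    rw [Finset.sum_smul]
    refine Eq.trans ?_ (h1.symm.trans ?_)
    · rw [hcard]
      refine Finset.sum_congr rfl fun S hS => ?_
      rw [Finset.mem_powersetCard] at hS
      rw [Finset.sum_eq_single (range n \ S)]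
      · rw [smul_mul_smul_comm, ← one_tmul_mul, yProd_mul_yProd_compl hS.1,
          one_tmul_neg_one_pow_smul, smul_smul, hS.2, mul_comm]
      · intro U hU hUS
        rw [Finset.mem_powersetCard] at hU
        rw [smul_mul_smul_comm, ← one_tmul_mul, yProd_mul_yProd_of_not_disjoint,
          TensorProduct.tmul_zero, smul_zero]
        intro hd
        refine hUS (Finset.eq_of_subset_of_card_le ?_ ?_)
        · exact Finset.subset_sdiff.2 ⟨hU.1, hd.symm⟩
        · rw [hU.2, Finset.card_sdiff_of_subset hB, Finset.card_sdiff_of_subset hS.1, hS.2]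
      · intro h
        refine absurd (Finset.mem_powersetCard.2 ⟨Finset.sdiff_subset, ?_⟩) h
        rw [Finset.card_sdiff_of_subset hB, Finset.card_sdiff_of_subset hS.1, hS.2]
    · rw [← one_tmul_mul]
      split_ifs with h
      · subst h
        rw [yProd_mul_yProd_compl hB', one_tmul_neg_one_pow_smul, map_smul,
          substY_yProd _ subset_rfl, Finset.powersetCard_self, Finset.sum_singleton, smul_smul,
          minorDet_transpose]
      · rw [yProd_mul_yProd_of_not_disjoint, TensorProduct.tmul_zero, map_zero, zero_smul]
        intro hd
        refine h (Finset.eq_of_subset_of_card_le (fun b hb => ?_) hcard.ge)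
        by_contra hbB
        exact Finset.disjoint_left.1 hd hb (Finset.mem_sdiff.2 ⟨hB' hb, hbB⟩)
  have h2 := congrArg (fun z => (-1) ^ (#B).choose 2 * z) (smul_yProd_cancel subset_rfl key)
  have hsq : ((-1 : SV F n) ^ (#B).choose 2) * (-1) ^ (#B).choose 2 = 1 := by
    rw [← mul_pow]; simp
  simp only [Finset.mul_sum, pow_add, mul_ite, mul_zero, ← mul_assoc, hsq, one_mul] at h2
  exact h2

end Laplace

section MuiElements

variable {F : Type} [Field F] {n : ℕ}

/-- The Moore matrix `(x_t^{q^c})`. -/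
def mooreEntry (F : Type) [Field F] (q n : ℕ) (c t : ℕ) : SV F n := xV F n t ^ q ^ c

theorem subDet_eq_minorDet (q : ℕ) (R C : Finset ℕ) :
    subDet F q n R C = minorDet (mooreEntry F q n) R C := rfl

theorem neg_one_pow_smul_tmul (k : ℕ) (s : SV F n) (y : LV F n) :
    ((-1 : F) ^ k • (s ⊗ₜ[F] y) : SL F n) = ((-1) ^ k * s) • (1 ⊗ₜ[F] y : SL F n) := by
  rw [← algebraMap_smul (SV F n), map_pow, map_neg, map_one, TensorProduct.smul_tmul',
    TensorProduct.smul_tmul', smul_eq_mul, smul_eq_mul, mul_one]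

theorem substY_MuiM (q : ℕ) {B : Finset ℕ} (hB : B ⊆ range n) :
    substY (mooreEntry F q n) (MuiM F q n n B) =
      ((-1) ^ (#B * (#B + 1) / 2 + (∑ b ∈ B, b) + #B) * subDet F q n (range n) (range n)) •
        (1 ⊗ₜ[F] yProd F n B) := by
  rw [MuiM, map_sum]
  have h : ∀ S ∈ (range n).powersetCard #B,
      substY (mooreEntry F q n) ((-1 : F) ^ (#B * (#B + 1) / 2 + (∑ s ∈ S, s) + #B) •
        (subDet F q n (range n \ B) (range n \ S) ⊗ₜ[F] yProd F n S)) =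
      ∑ B' ∈ (range n).powersetCard #B,
        ((-1) ^ (#B * (#B + 1) / 2 + #B) * ((-1) ^ (∑ s ∈ S, s) *
          minorDet (mooreEntry F q n) B' S *
          minorDet (mooreEntry F q n) (range n \ B) (range n \ S))) •
          (1 ⊗ₜ[F] yProd F n B' : SL F n) := by
    intro S hS
    rw [Finset.mem_powersetCard] at hS
    rw [neg_one_pow_smul_tmul, map_smul, substY_yProd _ hS.1, hS.2, Finset.smul_sum]
    refine Finset.sum_congr rfl fun B' _ => ?_
    rw [smul_smul, subDet_eq_minorDet]
    congr 1
    ring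
  rw [Finset.sum_congr rfl h, Finset.sum_comm]
  have h' : ∀ B' ∈ (range n).powersetCard #B,
      ∑ S ∈ (range n).powersetCard #B,
        ((-1) ^ (#B * (#B + 1) / 2 + #B) * ((-1) ^ (∑ s ∈ S, s) *
          minorDet (mooreEntry F q n) B' S *
          minorDet (mooreEntry F q n) (range n \ B) (range n \ S))) •
          (1 ⊗ₜ[F] yProd F n B' : SL F n) =
      ((-1) ^ (#B * (#B + 1) / 2 + #B) * if B' = B then (-1) ^ (∑ s ∈ B, s) *
        minorDet (mooreEntry F q n) (range n) (range n) else 0) • (1 ⊗ₜ[F] yProd F n B') := by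
    intro B' hB'
    rw [Finset.mem_powersetCard] at hB'
    rw [← Finset.sum_smul, ← Finset.mul_sum, laplace_minorDet _ hB hB'.1 hB'.2]
  rw [Finset.sum_congr rfl h', Finset.sum_eq_single B]
  · rw [if_pos rfl, subDet_eq_minorDet]
    congr 1
    ring
  · intro B' _ hne
    rw [if_neg hne, mul_zero, zero_smul]
  · intro h
    exact absurd (Finset.mem_powersetCard.2 ⟨hB, rfl⟩) h

theorem orderEmbOfFin_range (k : ℕ) (h : #(range k) = k) (i : Fin k) :
    (range k).orderEmbOfFin h i = i :=
  (congrFun (Finset.orderEmbOfFin_unique h (f := fun i : Fin k => (i : ℕ))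
    (fun i => Finset.mem_range.2 i.2) Fin.val_strictMono) i).symm

theorem minorDet_range {A : Type*} [CommRing A] (w : ℕ → ℕ → A) (k : ℕ) :
    minorDet w (range k) (range k) = (Matrix.of fun i j : Fin k => w i j).det := by
  rw [minorDet_eq w (Finset.card_range k) (Finset.card_range k)]
  simp [orderEmbOfFin_range]

theorem substY_injective (w : ℕ → ℕ → SV F n) (hw : minorDet w (range n) (range n) ≠ 0) :
    Function.Injective (substY w) := by
  set A : Matrix (Fin n) (Fin n) (SV F n) := Matrix.of fun i j => w i j with hA
  set w' : ℕ → ℕ → SV F n := fun s b =>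
    if h : s < n ∧ b < n then A.adjugate ⟨s, h.1⟩ ⟨b, h.2⟩ else 0 with hw'
  have hy : ∀ t < n, substY w' (substY w (1 ⊗ₜ[F] yV F n t)) = A.det • (1 ⊗ₜ[F] yV F n t) := by
    intro t ht
    have hsmul : ∀ (s : SV F n) (y : LV F n), (s ⊗ₜ[F] y : SL F n) = s • (1 ⊗ₜ[F] y) := by
      intro s y
      rw [TensorProduct.smul_tmul', smul_eq_mul, mul_one]
    rw [substY_yV w ht, map_sum]
    have h : ∀ b ∈ range n, substY w' (w b t ⊗ₜ[F] yV F n b) =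
        ∑ s ∈ range n, (w' s b * w b t) • (1 ⊗ₜ[F] yV F n s : SL F n) := by
      intro b hb
      rw [hsmul, map_smul, substY_yV w' (Finset.mem_range.1 hb), Finset.smul_sum]
      refine Finset.sum_congr rfl fun s _ => ?_
      rw [hsmul, smul_smul, mul_comm]
    rw [Finset.sum_congr rfl h, Finset.sum_comm]
    simp_rw [← Finset.sum_smul]
    have h2 : ∀ s ∈ range n, (∑ b ∈ range n, w' s b * w b t) • (1 ⊗ₜ[F] yV F n s : SL F n) =
        if s = t then A.det • (1 ⊗ₜ[F] yV F n t) else 0 := by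
      intro s hs
      rw [Finset.mem_range] at hs
      have h3 : ∑ b ∈ range n, w' s b * w b t = (A.adjugate * A) ⟨s, hs⟩ ⟨t, ht⟩ := by
        rw [Matrix.mul_apply, Finset.sum_range]
        refine Finset.sum_congr rfl fun b _ => ?_
        simp [hw', hs, hA]
      rw [h3, Matrix.adjugate_mul, Matrix.smul_apply, Matrix.one_apply]
      simp only [Fin.mk.injEq]
      split_ifs with hst
      · rw [smul_eq_mul, mul_one, hst]
      · rw [smul_zero, zero_smul]
    rw [Finset.sum_congr rfl h2, Finset.sum_ite_eq', if_pos (Finset.mem_range.2 ht)]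
  have hT : ∀ T ⊆ range n, substY w' (substY w (1 ⊗ₜ[F] yProd F n T)) =
      A.det ^ #T • (1 ⊗ₜ[F] yProd F n T) := by
    intro T
    induction T using Finset.induction_on_min with
    | empty =>
      intro _
      rw [yProd_empty, ← Algebra.TensorProduct.one_def]
      simp
    | insert t T ht ih =>
      intro hT
      rw [Finset.insert_subset_iff] at hT
      rw [yProd_insert_of_lt ht, one_tmul_mul, map_mul, map_mul, hy t (Finset.mem_range.1 hT.1),
        ih hT.2, smul_mul_smul_comm,
        Finset.card_insert_of_notMem fun h => lt_irrefl _ (ht t h), pow_succ']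
  rw [injective_iff_map_eq_zero]
  intro f hf
  obtain ⟨c, rfl⟩ := exists_eq_sum_smul_yProd f
  have h0 := congrArg (substY w') hf
  rw [map_zero, map_sum, map_sum] at h0
  have h1 : ∀ T ∈ (range n).powerset,
      substY w' (substY w (c T • (1 ⊗ₜ[F] yProd F n T : SL F n))) =
        (c T * A.det ^ #T) • (1 ⊗ₜ[F] yProd F n T) := by
    intro T hT'
    rw [map_smul, map_smul, hT T (Finset.mem_powerset.1 hT'), smul_smul]
  rw [Finset.sum_congr rfl h1] at h0
  refine Finset.sum_eq_zero fun T hT' => ?_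
  have h2 := eq_zero_of_sum_smul_yProd_eq_zero (c := fun T => c T * A.det ^ #T) h0
    (Finset.mem_powerset.1 hT')
  rw [minorDet_range] at hw
  rw [(mul_eq_zero.1 h2).resolve_right (pow_ne_zero _ hw), zero_smul]

end MuiElements

section Equivariance

/-- An iterated `#F`-power Frobenius map is `F`-linear on every commutative `F`-algebra. -/
theorem sum_smul_pow_card_pow {F : Type} [Field F] [Fintype F] {q : ℕ} (hF : Fintype.card F = q)
    {A : Type*} [CommRing A] [Algebra F A] {ι : Type*} (s : Finset ι) (c : ι → F) (v : ι → A)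
    (b : ℕ) : (∑ i ∈ s, c i • v i) ^ q ^ b = ∑ i ∈ s, c i • v i ^ q ^ b := by
  subst hF
  have h : ∀ a : A, (FiniteField.frobeniusAlgHom F A ^ b) a = a ^ Fintype.card F ^ b := by
    intro a
    rw [AlgHom.coe_pow, FiniteField.coe_frobeniusAlgHom, pow_iterate]
  rw [← h, map_sum]
  exact Finset.sum_congr rfl fun i _ => by rw [map_smul, h]

variable {F : Type} [Field F] {n : ℕ}

theorem xV_of_lt {t : ℕ} (ht : t < n) : xV F n t = X ⟨t, ht⟩ := dif_pos ht

theorem xV_fin (i : Fin n) : xV F n i = X i := dif_pos i.2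

theorem gAct_X (g : Matrix (Fin n) (Fin n) F) (j : Fin n) :
    gAct F n g (X j) = ∑ i, g i j • X i := by
  rw [gAct, MvPolynomial.aeval_X]
  exact Finset.sum_congr rfl fun i _ => (MvPolynomial.smul_eq_C_mul _ _).symm

theorem gAct_mooreEntry [Fintype F] {q : ℕ} (hF : Fintype.card F = q)
    (g : Matrix (Fin n) (Fin n) F) (c : ℕ) (j : Fin n) :
    gAct F n g (mooreEntry F q n c j) = ∑ i : Fin n, g i j • mooreEntry F q n c i := by
  simp only [mooreEntry, xV_fin]
  rw [map_pow, gAct_X, sum_smul_pow_card_pow hF]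

theorem gAct_subDet [Fintype F] {q : ℕ} (hF : Fintype.card F = q)
    (g : Matrix (Fin n) (Fin n) F) (R : Finset ℕ) :
    gAct F n g (subDet F q n R (range n)) = C g.det * subDet F q n R (range n) := by
  rw [subDet_eq_minorDet]
  by_cases h : #R = n
  · rw [minorDet_eq _ h (Finset.card_range n), AlgHom.map_det, mul_comm, RingHom.map_det,
      ← Matrix.det_mul]
    congr 1
    ext1 i j
    simp only [AlgHom.mapMatrix_apply, Matrix.map_apply, Matrix.of_apply, orderEmbOfFin_range,
      Matrix.mul_apply, RingHom.mapMatrix_apply]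
    rw [gAct_mooreEntry hF]
    exact Finset.sum_congr rfl fun k _ => by rw [MvPolynomial.smul_eq_C_mul, mul_comm]
  · rw [minorDet, dif_neg (by rw [Finset.card_range]; exact Ne.symm h), map_zero, mul_zero]

/-- The action of a matrix on the first factor of `S(V) ⊗ Λ(V)`. -/
def sAct (g : Matrix (Fin n) (Fin n) F) : SL F n →ₐ[F] SL F n :=
  Algebra.TensorProduct.map (gAct F n g) (AlgHom.id F (LV F n))

theorem sAct_smul_one_tmul (g : Matrix (Fin n) (Fin n) F) (a : SV F n) (y : LV F n) :
    sAct g (a • (1 ⊗ₜ[F] y : SL F n)) = gAct F n g a • (1 ⊗ₜ[F] y : SL F n) := by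
  rw [TensorProduct.smul_tmul', TensorProduct.smul_tmul', smul_eq_mul, smul_eq_mul, mul_one,
    mul_one, sAct, Algebra.TensorProduct.map_tmul, AlgHom.id_apply]

theorem yV_fin (i : Fin n) : yV F n i = ExteriorAlgebra.ι F (Pi.single i (1 : F)) := dif_pos i.2

theorem eAct_yV (g : Matrix (Fin n) (Fin n) F) (j : Fin n) :
    eAct F n g (yV F n j) = ∑ i : Fin n, g i j • yV F n i := by
  simp only [yV_fin]
  rw [eAct, ExteriorAlgebra.map_apply_ι, Matrix.mulVecLin_apply, Matrix.mulVec_single_one]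
  simp_rw [← map_smul]
  rw [← map_sum]
  congr 1
  ext i
  simp [Finset.sum_apply, Pi.single_apply]

theorem substY_tAct [Fintype F] {q : ℕ} (hF : Fintype.card F = q)
    (g : Matrix (Fin n) (Fin n) F) (f : SL F n) :
    substY (mooreEntry F q n) (tAct F n g f) = sAct g (substY (mooreEntry F q n) f) := by
  have key : ((substY (mooreEntry F q n)).restrictScalars F).comp (tAct F n g) =
      (sAct g).comp ((substY (mooreEntry F q n)).restrictScalars F) := by
    apply Algebra.TensorProduct.ext
    · ext j
      simp [tAct, sAct, substY, Algebra.ofId_apply]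
    · apply ExteriorAlgebra.hom_ext
      refine LinearMap.pi_ext' fun j => LinearMap.ext_ring ?_
      have hy : ∀ t : Fin n, substY (mooreEntry F q n) (1 ⊗ₜ[F] yV F n t) =
          ∑ b ∈ range n, mooreEntry F q n b t ⊗ₜ[F] yV F n b := fun t => substY_yV _ t.2
      have h : substY (mooreEntry F q n) (tAct F n g (1 ⊗ₜ[F] yV F n j)) =
          sAct g (substY (mooreEntry F q n) (1 ⊗ₜ[F] yV F n j)) := by
        rw [hy, map_sum, tAct, Algebra.TensorProduct.map_tmul, map_one, eAct_yV,
          TensorProduct.tmul_sum, map_sum]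
        simp_rw [sAct, Algebra.TensorProduct.map_tmul, gAct_mooreEntry hF, TensorProduct.sum_tmul,
          AlgHom.id_apply]
        rw [Finset.sum_comm]
        refine Finset.sum_congr rfl fun i _ => ?_
        rw [TensorProduct.tmul_smul, ← AlgHom.restrictScalars_apply F, map_smul,
          AlgHom.restrictScalars_apply, hy, Finset.smul_sum]
        exact Finset.sum_congr rfl fun b _ => TensorProduct.smul_tmul' _ _ _
      rw [yV_fin] at h
      exact h
  exact DFunLike.congr_fun key f

theorem gAct_coeff_eq [Fintype F] {q : ℕ} (hF : Fintype.card F = q) {g : Matrix (Fin n) (Fin n) F}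
    {f : SL F n} (hf : tAct F n g f = f) {a : Finset ℕ → SV F n}
    (ha : substY (mooreEntry F q n) f =
      ∑ B ∈ (range n).powerset, a B • (1 ⊗ₜ[F] yProd F n B : SL F n))
    {B : Finset ℕ} (hB : B ⊆ range n) : gAct F n g (a B) = a B := by
  refine eq_of_sum_smul_yProd_eq (c := fun B => gAct F n g (a B)) ?_ hB
  have h := substY_tAct hF g f
  rw [hf] at h
  rw [← ha, h, ha, map_sum]
  exact Finset.sum_congr rfl fun B _ => (sAct_smul_one_tmul g _ _).symm

theorem tAct_MuiM [Fintype F] {q : ℕ} (hF : Fintype.card F = q)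
    (hL : subDet F q n (range n) (range n) ≠ 0) {g : Matrix (Fin n) (Fin n) F} (hg : g.det = 1)
    {B : Finset ℕ} (hB : B ⊆ range n) : tAct F n g (MuiM F q n n B) = MuiM F q n n B := by
  apply substY_injective (mooreEntry F q n) hL
  rw [substY_tAct hF, substY_MuiM q hB, sAct_smul_one_tmul, map_mul, gAct_subDet hF, hg, map_one,
    one_mul, map_pow, map_neg, map_one]

end Equivariance

section MooreDeterminant

variable {F : Type} [Field F] [Fintype F] {A : Type*} [CommRing A]

/-- The Moore determinant `det (v_j^{q^i})`. -/
def mooreDet (q : ℕ) {m : ℕ} (v : Fin m → A) : A :=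
  (Matrix.of fun i j : Fin m => v j ^ q ^ (i : ℕ)).det

theorem mooreDet_snoc (q : ℕ) {m : ℕ} (v : Fin m → A) (z : A) :
    mooreDet q (Fin.snoc v z : Fin (m + 1) → A) =
      ∑ k : Fin (m + 1), (-1) ^ ((k : ℕ) + m) *
        (Matrix.of fun i j : Fin m => v j ^ q ^ (k.succAbove i : ℕ)).det * z ^ q ^ (k : ℕ) := by
  rw [mooreDet, Matrix.det_succ_column _ (Fin.last m)]
  refine Finset.sum_congr rfl fun k _ => ?_
  have : (Matrix.of fun i j : Fin (m + 1) =>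
      (Fin.snoc v z : Fin (m + 1) → A) j ^ q ^ (i : ℕ)).submatrix k.succAbove
        (Fin.last m).succAbove = Matrix.of fun i j : Fin m => v j ^ q ^ (k.succAbove i : ℕ) := by
    ext i j
    simp
  rw [this]
  simp
  ring

/-- The polynomial whose value at `z` is the Moore determinant of `(v, z)`. -/
def moorePoly (q : ℕ) {m : ℕ} (v : Fin m → A) : Polynomial A :=
  ∑ k : Fin (m + 1), Polynomial.C ((-1) ^ ((k : ℕ) + m) *
    (Matrix.of fun i j : Fin m => v j ^ q ^ (k.succAbove i : ℕ)).det) *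
      Polynomial.X ^ q ^ (k : ℕ)

theorem eval_moorePoly (q : ℕ) {m : ℕ} (v : Fin m → A) (z : A) :
    (moorePoly q v).eval z = mooreDet q (Fin.snoc v z : Fin (m + 1) → A) := by
  rw [mooreDet_snoc, moorePoly, Polynomial.eval_finsetSum]
  simp only [Polynomial.eval_mul, Polynomial.eval_C, Polynomial.eval_pow, Polynomial.eval_X]

theorem coeff_moorePoly {q : ℕ} (hq : 1 < q) {m : ℕ} (v : Fin m → A) {d : ℕ} (hd : q ^ m ≤ d) :
    (moorePoly q v).coeff d = if d = q ^ m then mooreDet q v else 0 := by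
  rw [moorePoly, Polynomial.finsetSum_coeff, Fin.sum_univ_castSucc, Finset.sum_eq_zero, zero_add]
  · simp only [Polynomial.coeff_C_mul, Polynomial.coeff_X_pow, Fin.val_last, mul_ite, mul_one,
      mul_zero, ← two_mul, pow_mul, neg_one_sq, one_pow, one_mul]
    simp [mooreDet]
  · intro k _
    rw [Polynomial.coeff_C_mul, Polynomial.coeff_X_pow, if_neg, mul_zero]
    exact (lt_of_lt_of_le (Nat.pow_lt_pow_right hq k.2) hd).ne'

variable [Algebra F A]

theorem mooreDet_snoc_sum [IsDomain A] {q : ℕ} (hF : Fintype.card F = q) {m : ℕ} (v : Fin m → A)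
    (c : Fin m → F) : mooreDet q (Fin.snoc v (∑ k, c k • v k) : Fin (m + 1) → A) = 0 := by
  refine Matrix.exists_mulVec_eq_zero_iff.1
    ⟨(Fin.snoc (fun k => algebraMap F A (c k)) (-1) : Fin (m + 1) → A), fun h => ?_, ?_⟩
  · have := congrFun h (Fin.last m)
    simp at this
  · ext i
    simp only [Matrix.mulVec, dotProduct, Fin.sum_univ_castSucc, Matrix.of_apply,
      Fin.snoc_castSucc, Fin.snoc_last, sum_smul_pow_card_pow hF, Pi.zero_apply, mul_neg, mul_one]
    rw [add_neg_eq_zero]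
    exact Finset.sum_congr rfl fun k _ => by rw [Algebra.smul_def, mul_comm]

theorem moorePoly_eq_prod [IsDomain A] {q : ℕ} (hF : Fintype.card F = q) {m : ℕ} {v : Fin m → A}
    (hv : LinearIndependent F v) :
    moorePoly q v = Polynomial.C (mooreDet q v) *
      ∏ c : Fin m → F, (Polynomial.X - Polynomial.C (∑ k, c k • v k)) := by
  classical
  have hq : 1 < q := hF ▸ Fintype.one_lt_card
  have hcard : #(Finset.univ : Finset (Fin m → F)) = q ^ m := by
    rw [Finset.card_univ, Fintype.card_fun, Fintype.card_fin, hF]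
  have hmonic := Polynomial.monic_prod_of_monic (Finset.univ : Finset (Fin m → F))
    (fun c => Polynomial.X - Polynomial.C (∑ k, c k • v k)) fun c _ => Polynomial.monic_X_sub_C _
  have hdeg : (∏ c : Fin m → F,
      (Polynomial.X - Polynomial.C (∑ k, c k • v k))).natDegree = q ^ m := by
    rw [Polynomial.natDegree_prod_of_monic _ _ fun c _ => Polynomial.monic_X_sub_C _]
    simp only [Polynomial.natDegree_X_sub_C, Finset.sum_const, hcard, smul_eq_mul, mul_one]
  rw [← sub_eq_zero]
  refine Polynomial.eq_zero_of_degree_lt_of_eval_index_eq_zero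
    (Finset.univ : Finset (Fin m → F)) (v := fun c => ∑ k, c k • v k)
    (Function.Injective.injOn fun c d hcd => ?_) ?_ fun c _ => ?_
  · exact linearIndependent_iff_injective_fintypeLinearCombination.1 hv
      (by simpa [Fintype.linearCombination_apply] using! hcd)
  · rw [hcard, Polynomial.degree_lt_iff_coeff_zero]
    intro d hd
    rw [Polynomial.coeff_sub, coeff_moorePoly hq v hd, Polynomial.coeff_C_mul]
    split_ifs with h
    · rw [h, ← hdeg, hmonic.coeff_natDegree, mul_one, sub_self]
    · rw [Polynomial.coeff_eq_zero_of_natDegree_lt (by rw [hdeg]; omega), mul_zero, sub_zero]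
  · rw [Polynomial.eval_sub, eval_moorePoly, mooreDet_snoc_sum hF, Polynomial.eval_mul,
      Polynomial.eval_prod, Finset.prod_eq_zero (Finset.mem_univ c) (by
        rw [Polynomial.eval_sub, Polynomial.eval_X, Polynomial.eval_C, sub_self]), mul_zero, sub_zero]

theorem mooreDet_snoc_eq_prod [IsDomain A] {q : ℕ} (hF : Fintype.card F = q) {m : ℕ}
    {v : Fin m → A} (hv : LinearIndependent F v) (z : A) :
    mooreDet q (Fin.snoc v z : Fin (m + 1) → A) =
      mooreDet q v * ∏ c : Fin m → F, (z - ∑ k, c k • v k) := by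
  rw [← eval_moorePoly, moorePoly_eq_prod hF hv, Polynomial.eval_mul, Polynomial.eval_prod]
  simp only [Polynomial.eval_sub, Polynomial.eval_X, Polynomial.eval_C]

end MooreDeterminant

section DicksonInvariants

variable {F : Type} [Field F] {n : ℕ}

theorem linearIndependent_xV {m : ℕ} (hm : m ≤ n) :
    LinearIndependent F fun k : Fin m => xV F n k := by
  have h := (MvPolynomial.linearIndependent_X (Fin n) F).comp _ (Fin.castLE_injective hm)
  have hk : (fun k : Fin m => xV F n k) = X ∘ Fin.castLE hm :=
    funext fun k => xV_of_lt (lt_of_lt_of_le k.2 hm)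
  rw [hk]
  exact h

theorem linProd_eq [Fintype F] (a t : ℕ) :
    linProd F n a t = ∏ c : Fin a → F, (xV F n t - ∑ k : Fin a, c k • xV F n k) := by
  rw [linProd]
  refine Fintype.prod_equiv (Equiv.neg _) _ _ fun c => ?_
  simp only [Equiv.neg_apply, Pi.neg_apply, neg_smul, Finset.sum_neg_distrib, sub_neg_eq_add,
    MvPolynomial.smul_eq_C_mul]
  rw [add_comm]

theorem mooreDet_xV [Fintype F] {q : ℕ} (hF : Fintype.card F = q) {m : ℕ} (hm : m ≤ n) :
    mooreDet q (fun k : Fin m => xV F n k) = Lm F n m := by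
  induction m with
  | zero => simp [mooreDet, Lm]
  | succ m ih =>
    have : (fun k : Fin (m + 1) => xV F n k) =
        (Fin.snoc (fun k : Fin m => xV F n k) (xV F n m) : Fin (m + 1) → SV F n) := by
      ext1 k
      refine Fin.lastCases ?_ (fun k => ?_) k <;> simp
    rw [this, mooreDet_snoc_eq_prod hF (linearIndependent_xV (by omega)), ih (by omega), Lm, Lm,
      Finset.prod_range_succ, linProd_eq]

theorem subDet_range_range [Fintype F] {q : ℕ} (hF : Fintype.card F = q) :
    subDet F q n (range n) (range n) = Lm F n n := by
  rw [← mooreDet_xV hF le_rfl, subDet_eq_minorDet, minorDet_range]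
  rfl

theorem linProd_ne_zero [Fintype F] {a : ℕ} (ha : a < n) : linProd F n a a ≠ 0 := by
  rw [linProd_eq, Finset.prod_ne_zero_iff]
  intro c _ h
  have h2 := (linearIndependent_xV (F := F) (n := n) (m := a + 1) ha)
  rw [Fintype.linearIndependent_iff] at h2
  have h3 := h2 (Fin.snoc (fun k => -c k) 1) (by
    rw [Fin.sum_univ_castSucc]
    simp only [Fin.snoc_castSucc, Fin.snoc_last, Fin.val_castSucc, Fin.val_last, neg_smul,
      Finset.sum_neg_distrib, one_smul]
    rw [neg_add_eq_sub, h]) (Fin.last a)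
  simp at h3

theorem Lm_ne_zero [Fintype F] : Lm F n n ≠ 0 :=
  Finset.prod_ne_zero_iff.2 fun _ ha => linProd_ne_zero (Finset.mem_range.1 ha)

theorem subDet_range_sdiff (q : ℕ) (k : Fin (n + 1)) :
    subDet F q n (range (n + 1) \ {(k : ℕ)}) (range n) =
      (Matrix.of fun i j : Fin n => xV F n j ^ q ^ (k.succAbove i : ℕ)).det := by
  have hk : (k : ℕ) ∈ range (n + 1) := Finset.mem_range.2 k.2
  have hc : #(range (n + 1) \ {(k : ℕ)}) = n := by
    rw [Finset.card_sdiff_of_subset (Finset.singleton_subset_iff.2 hk)]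
    simp
  rw [subDet_eq_minorDet, minorDet_eq _ hc (Finset.card_range n)]
  have h : ∀ i : Fin n, (range (n + 1) \ {(k : ℕ)}).orderEmbOfFin hc i = k.succAbove i := by
    intro i
    refine (congrFun (Finset.orderEmbOfFin_unique hc (f := fun i : Fin n => (k.succAbove i : ℕ))
      (fun i => ?_) fun i j hij => ?_) i).symm
    · rw [Finset.mem_sdiff, Finset.mem_range, Finset.mem_singleton]
      exact ⟨(k.succAbove i).2, fun h => Fin.succAbove_ne k i (Fin.ext h)⟩
    · exact Fin.strictMono_succAbove k hij
  simp_rw [h, orderEmbOfFin_range]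
  rfl

variable [Fintype F] {q : ℕ} {Q : (m : ℕ) → ℕ → SV F m}

theorem dickson_self (hF : Fintype.card F = q) (hQ : DicksonProp F q Q) : Q n n = 1 := by
  have h := hQ n n le_rfl
  rw [show range (n + 1) \ {n} = range n by ext; simp; omega, subDet_range_range hF] at h
  exact mul_right_cancel₀ Lm_ne_zero (h.trans (one_mul _).symm)

theorem dickson_zero (hF : Fintype.card F = q) (hQ : DicksonProp F q Q) :
    Q n 0 = Lm F n n ^ (q - 1) := by
  have hq : q ≠ 0 := hF ▸ Fintype.card_ne_zero
  have h := hQ n 0 n.zero_le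
  have h2 := subDet_range_sdiff (F := F) (n := n) q 0
  rw [Fin.val_zero] at h2
  refine mul_right_cancel₀ Lm_ne_zero ?_
  rw [h, h2, pow_sub_one_mul hq, ← subDet_range_range hF, subDet_eq_minorDet, minorDet_range]
  subst hF
  rw [← FiniteField.frobeniusAlgHom_apply (K := F) (R := SV F n), AlgHom.map_det]
  congr 1
  ext1 i j
  simp [mooreEntry, ← pow_mul, pow_succ]

/-- The fundamental equation of the Dickson invariants. -/
theorem sum_dickson (hF : Fintype.card F = q) (hQ : DicksonProp F q Q) :
    ∑ k : Fin (n + 1), Polynomial.C ((-1) ^ ((k : ℕ) + n) * Q n k) * Polynomial.X ^ q ^ (k : ℕ) =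
      ∏ c : Fin n → F, (Polynomial.X - Polynomial.C (∑ k, c k • (X k : SV F n))) := by
  have h := moorePoly_eq_prod hF (linearIndependent_xV (F := F) (n := n) le_rfl)
  rw [mooreDet_xV hF le_rfl] at h
  simp only [xV_fin] at h
  refine mul_left_cancel₀ (Polynomial.C_ne_zero.2 Lm_ne_zero) (Eq.trans ?_ h)
  rw [Finset.mul_sum, moorePoly]
  refine Finset.sum_congr rfl fun k _ => ?_
  have hk := (hQ n k (Nat.le_of_lt_succ k.2)).trans (subDet_range_sdiff q k)
  simp only [xV_fin] at hk
  rw [← hk, ← mul_assoc, ← Polynomial.C_mul]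
  congr 2
  ring

end DicksonInvariants

section DicksonTheorem

variable {F : Type} [Field F] [Fintype F] {q n : ℕ} {Q : (m : ℕ) → ℕ → SV F m}

/-- The generators `L_n, Q_{n,1}, …, Q_{n,n-1}`. -/
def dicksonGen (Q : (m : ℕ) → ℕ → SV F m) (k : Fin n) : SV F n :=
  if (k : ℕ) = 0 then Lm F n n else Q n k

/-- The algebra generated by `L_n, Q_{n,1}, …, Q_{n,n-1}`. -/
abbrev dicksonAlg (n : ℕ) (Q : (m : ℕ) → ℕ → SV F m) : Subalgebra F (SV F n) :=
  Algebra.adjoin F (Set.range (dicksonGen (n := n) Q))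

theorem Lm_mem_dicksonAlg : Lm F n n ∈ dicksonAlg n Q := by
  rcases Nat.eq_zero_or_pos n with rfl | hn
  · rw [Lm, Finset.range_zero, Finset.prod_empty]
    exact one_mem _
  · exact Algebra.subset_adjoin ⟨⟨0, hn⟩, if_pos rfl⟩

theorem dickson_mem_dicksonAlg (hF : Fintype.card F = q) (hQ : DicksonProp F q Q) {k : ℕ}
    (hk : k ≤ n) : Q n k ∈ dicksonAlg n Q := by
  rcases hk.eq_or_lt with rfl | hk
  · rw [dickson_self hF hQ]
    exact one_mem _
  rcases Nat.eq_zero_or_pos k with rfl | h0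
  · rw [dickson_zero hF hQ]
    exact pow_mem Lm_mem_dicksonAlg _
  · exact Algebra.subset_adjoin ⟨⟨k, hk⟩, if_neg h0.ne'⟩

theorem exists_map_eq_prod (hF : Fintype.card F = q) (hQ : DicksonProp F q Q) :
    ∃ P : Polynomial (dicksonAlg n Q), P.map (algebraMap (dicksonAlg n Q) (SV F n)) =
      ∏ c : Fin n → F, (Polynomial.X - Polynomial.C (∑ k, c k • (X k : SV F n))) := by
  have hmem : ∀ k : Fin (n + 1), (-1) ^ ((k : ℕ) + n) * Q n k ∈ dicksonAlg n Q := fun k =>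
    mul_mem (pow_mem (neg_mem (one_mem _)) _)
      (dickson_mem_dicksonAlg hF hQ (Nat.le_of_lt_succ k.2))
  refine ⟨∑ k : Fin (n + 1), Polynomial.C ⟨_, hmem k⟩ * Polynomial.X ^ q ^ (k : ℕ), ?_⟩
  rw [← sum_dickson hF hQ, Polynomial.map_sum]
  refine Finset.sum_congr rfl fun k _ => ?_
  rw [Polynomial.map_mul, Polynomial.map_C, Polynomial.map_pow, Polynomial.map_X]
  rfl

theorem algebra_isIntegral_dicksonAlg (hF : Fintype.card F = q) (hQ : DicksonProp F q Q) :
    Algebra.IsIntegral (dicksonAlg n Q) (SV F n) := by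
  obtain ⟨P, hP⟩ := exists_map_eq_prod (n := n) hF hQ
  have hX : ∀ i : Fin n, IsIntegral (dicksonAlg n Q) (X i : SV F n) := by
    intro i
    refine ⟨P, Polynomial.monic_of_injective (f := algebraMap (dicksonAlg n Q) (SV F n))
      Subtype.val_injective ?_, ?_⟩
    · rw [hP]
      exact Polynomial.monic_prod_of_monic _ _ fun c _ => Polynomial.monic_X_sub_C _
    · rw [← Polynomial.eval_map, hP, Polynomial.eval_prod]
      refine Finset.prod_eq_zero (Finset.mem_univ (Pi.single i 1)) ?_
      rw [Polynomial.eval_sub, Polynomial.eval_X, Polynomial.eval_C, Finset.sum_eq_single i,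
        Pi.single_eq_same, one_smul, sub_self]
      · intro j _ hj
        rw [Pi.single_eq_of_ne hj, zero_smul]
      · exact fun h => absurd (Finset.mem_univ i) h
  refine ⟨fun f => ?_⟩
  induction f using MvPolynomial.induction_on with
  | C a => exact isIntegral_algebraMap (x := algebraMap F (dicksonAlg n Q) a)
  | add a b ha hb => exact ha.add hb
  | mul_X a i ha => exact ha.mul (hX i)

theorem isIntegrallyClosed_dicksonAlg (hF : Fintype.card F = q) (hQ : DicksonProp F q Q) :
    IsIntegrallyClosed (dicksonAlg n Q) := by
  have := algebra_isIntegral_dicksonAlg (n := n) hF hQ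
  have halg : Algebra.IsAlgebraic (dicksonAlg n Q) (SV F n) := inferInstance
  have h := Algebra.IsAlgebraic.isTranscendenceBasis_of_lift_le_trdeg_of_finite F
    (dicksonGen (n := n) Q) (by rw [MvPolynomial.trdeg_of_isDomain, Cardinal.lift_lift])
  exact IsIntegrallyClosed.of_equiv h.1.aevalEquiv.toRingEquiv

theorem gAct_Lm (hF : Fintype.card F = q) (g : Matrix (Fin n) (Fin n) F) :
    gAct F n g (Lm F n n) = C g.det * Lm F n n := by
  rw [← subDet_range_range hF, gAct_subDet hF]

theorem gAct_dickson (hF : Fintype.card F = q) (hQ : DicksonProp F q Q)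
    {g : Matrix (Fin n) (Fin n) F} (hg : g.det ≠ 0) {k : ℕ} (hk : k ≤ n) :
    gAct F n g (Q n k) = Q n k := by
  have h := congrArg (gAct F n g) (hQ n k hk)
  rw [gAct_subDet hF, ← hQ n k hk, map_mul, gAct_Lm hF, ← mul_assoc, ← mul_assoc,
    mul_comm _ (C g.det)] at h
  exact mul_left_cancel₀ (C_ne_zero.2 hg) (mul_right_cancel₀ Lm_ne_zero h)

theorem dicksonAlg_le_invS (hF : Fintype.card F = q) (hQ : DicksonProp F q Q) :
    dicksonAlg n Q ≤ invS F n (SLset F n) := by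
  refine Algebra.adjoin_le ?_
  rintro _ ⟨k, rfl⟩ g (hg : g.det = 1)
  rw [dicksonGen]
  split_ifs
  · rw [gAct_Lm hF, hg, map_one, one_mul]
  · exact gAct_dickson hF hQ (hg ▸ one_ne_zero) k.2.le

theorem mem_of_mem_invS (hF : Fintype.card F = q) (R : Subalgebra F (SV F n))
    [IsIntegrallyClosed R] [Algebra.IsIntegral R (SV F n)] (hLR : Lm F n n ∈ R)
    {P : Polynomial R} (hP : P.map (algebraMap R (SV F n)) =
      ∏ c : Fin n → F, (Polynomial.X - Polynomial.C (∑ k, c k • (X k : SV F n))))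
    (K E : Type) [Field K] [Algebra R K] [IsFractionRing R K] [Field E] [Algebra (SV F n) E]
    [IsFractionRing (SV F n) E] [Algebra K E] [IsScalarTower R K E]
    {f : SV F n} (hf : f ∈ invS F n (SLset F n)) : f ∈ R := by
  have hKE : ∀ r : R, algebraMap K E (algebraMap R K r) = algebraMap (SV F n) E r := fun r => by
    rw [← IsScalarTower.algebraMap_apply, IsScalarTower.algebraMap_apply R (SV F n) E]
    rfl
  have hmap : (P.map (algebraMap R K)).map (algebraMap K E) = ∏ c : Fin n → F,
      (Polynomial.X - Polynomial.C (algebraMap (SV F n) E (∑ k, c k • (X k : SV F n)))) := by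
    have h := congrArg (Polynomial.map (algebraMap (SV F n) E)) hP
    rw [Polynomial.map_map, Polynomial.map_prod] at h
    rw [Polynomial.map_map]
    refine Eq.trans ?_ (h.trans ?_)
    · congr 1
      exact RingHom.ext hKE
    · simp only [Polynomial.map_sub, Polynomial.map_X, Polynomial.map_C]
  have hroot : ∀ z : E, (∃ c : Fin n → F,
      z = algebraMap (SV F n) E (∑ k, c k • (X k : SV F n))) ↔
        Polynomial.aeval z (P.map (algebraMap R K)) = 0 := by
    intro z
    rw [Polynomial.aeval_def, ← Polynomial.eval_map, hmap, Polynomial.eval_prod,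
      Finset.prod_eq_zero_iff]
    simp only [Finset.mem_univ, true_and, Polynomial.eval_sub, Polynomial.eval_X,
      Polynomial.eval_C, sub_eq_zero]
  have hX : ∀ i : Fin n, (X i : SV F n) = ∑ k, (Pi.single i 1 : Fin n → F) k • X k := by
    intro i
    simp [Pi.single_apply]
  have hC : ∀ a : F, algebraMap (SV F n) E (C a) =
      algebraMap K E (algebraMap R K (algebraMap F R a)) := fun a => (hKE (algebraMap F R a)).symm
  have hsep : (P.map (algebraMap R K)).Separable := by
    rw [← Polynomial.separable_map (algebraMap K E), hmap,
      Polynomial.separable_prod_X_sub_C_iff]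
    refine (IsFractionRing.injective (SV F n) E).comp ?_
    exact linearIndependent_iff_injective_fintypeLinearCombination.1
      (MvPolynomial.linearIndependent_X (Fin n) F)
  have hne : P.map (algebraMap R K) ≠ 0 := hsep.ne_zero
  have hsplit : (P.map (algebraMap R K)).IsSplittingField K E := by
    rw [isSplittingField_iff_intermediateField]
    refine ⟨?_, ?_⟩
    · rw [hmap]
      exact Polynomial.Splits.prod fun c _ => Polynomial.Splits.X_sub_C _
    · rw [eq_top_iff]
      rintro z -
      have hS : ∀ s : SV F n, algebraMap (SV F n) E s ∈
          IntermediateField.adjoin K ((P.map (algebraMap R K)).rootSet E) := by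
        intro s
        induction s using MvPolynomial.induction_on with
        | C a =>
          rw [hC]
          exact IntermediateField.algebraMap_mem _ _
        | add a b ha hb =>
          rw [map_add]
          exact add_mem ha hb
        | mul_X a i ha =>
          rw [map_mul]
          refine mul_mem ha (IntermediateField.subset_adjoin _ _ ?_)
          rw [Polynomial.mem_rootSet]
          exact ⟨hne, (hroot _).1 ⟨Pi.single i 1, congrArg _ (hX i)⟩⟩
      obtain ⟨a, b, -, rfl⟩ := IsFractionRing.div_surjective (A := SV F n) z
      exact div_mem (hS a) (hS b)
  have hgal : IsGalois K E := IsGalois.of_separable_splitting_field hsep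
  have hfin : FiniteDimensional K E :=
    Polynomial.IsSplittingField.finiteDimensional E (P.map (algebraMap R K))
  have hfix : algebraMap (SV F n) E f ∈ Set.range (algebraMap K E) := by
    rw [IsGalois.mem_range_algebraMap_iff_fixed]
    intro σ
    have hσ : ∀ j : Fin n, ∃ c : Fin n → F, σ (algebraMap (SV F n) E (X j)) =
        algebraMap (SV F n) E (∑ k, c k • (X k : SV F n)) := by
      intro j
      rw [hroot, Polynomial.aeval_algEquiv, AlgHom.comp_apply, AlgEquiv.coe_toAlgHom,
        (hroot _).1 ⟨Pi.single j 1, congrArg _ (hX j)⟩, map_zero]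
    choose c hc using hσ
    have hact : ∀ s : SV F n, σ (algebraMap (SV F n) E s) =
        algebraMap (SV F n) E (gAct F n (Matrix.of fun i j => c j i) s) := by
      intro s
      induction s using MvPolynomial.induction_on with
      | C a =>
        rw [hC, AlgEquiv.commutes, ← hC]
        exact congrArg _ ((gAct F n _).commutes a).symm
      | add a b ha hb => simp only [map_add, ha, hb]
      | mul_X a i ha =>
        rw [map_mul, map_mul, map_mul, map_mul, ha, hc, gAct_X]
        rfl
    have hL : σ (algebraMap (SV F n) E (Lm F n n)) = algebraMap (SV F n) E (Lm F n n) := by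
      rw [← hKE ⟨Lm F n n, hLR⟩, AlgEquiv.commutes]
    rw [hact, gAct_Lm hF] at hL
    have hdet := IsFractionRing.injective (SV F n) E hL
    rw [mul_eq_right₀ Lm_ne_zero, ← C_1, C_inj] at hdet
    rw [hact, hf _ hdet]
  obtain ⟨z, hz⟩ := hfix
  have hzint : IsIntegral R z := by
    rw [← isIntegral_algebraMap_iff (algebraMap K E).injective, hz]
    exact (Algebra.IsIntegral.isIntegral f).algebraMap
  obtain ⟨r, rfl⟩ := IsIntegrallyClosed.isIntegral_iff.1 hzint
  rw [hKE] at hz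
  rw [← IsFractionRing.injective (SV F n) E hz]
  exact r.2

theorem exists_isFractionRing_isScalarTower {R E : Type} [CommRing R] [Field E] [Algebra R E]
    (h : Function.Injective (algebraMap R E)) :
    ∃ (K : Type) (_ : Field K) (_ : Algebra R K) (_ : IsFractionRing R K) (_ : Algebra K E),
      IsScalarTower R K E := by
  have := h.isDomain (algebraMap R E)
  have := (faithfulSMul_iff_algebraMap_injective R E).2 h
  exact ⟨FractionRing R, inferInstance, inferInstance, inferInstance,
    FractionRing.liftAlgebra R E, FractionRing.isScalarTower_liftAlgebra R E⟩

theorem invS_le_dicksonAlg (hF : Fintype.card F = q) (hQ : DicksonProp F q Q) :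
    invS F n (SLset F n) ≤ dicksonAlg n Q := by
  intro f hf
  have := isIntegrallyClosed_dicksonAlg (n := n) hF hQ
  have := algebra_isIntegral_dicksonAlg (n := n) hF hQ
  obtain ⟨P, hP⟩ := exists_map_eq_prod (n := n) hF hQ
  have hRE : Function.Injective (algebraMap (dicksonAlg n Q) (FractionRing (SV F n))) :=
    (IsFractionRing.injective (SV F n) (FractionRing (SV F n))).comp Subtype.val_injective
  obtain ⟨K, _, _, _, _, _⟩ := exists_isFractionRing_isScalarTower hRE
  exact mem_of_mem_invS hF _ Lm_mem_dicksonAlg hP K (FractionRing (SV F n)) hf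

end DicksonTheorem

section Divisibility

variable {F : Type} [Field F] {n : ℕ}

theorem sum_transvection_smul {M : Type*} [AddCommMonoid M] [Module F M] (a j t : Fin n)
    (v : Fin n → M) : ∑ i, Matrix.transvection a j (1 : F) i t • v i =
      v t + if t = j then v a else 0 := by
  simp only [Matrix.transvection, Matrix.add_apply, Matrix.one_apply, Matrix.single_apply,
    add_smul, ite_smul, one_smul, zero_smul, Finset.sum_add_distrib]
  congr 1
  · simp
  · by_cases h : t = j
    · simp [h]
    · simp [h, Ne.symm h]

theorem eAct_transvection_yProd_of_notMem {a j : Fin n} {T : Finset ℕ} (hj : (j : ℕ) ∉ T) :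
    eAct F n (Matrix.transvection a j 1) (yProd F n T) = yProd F n T := by
  induction T using Finset.induction_on_min with
  | empty => rw [yProd_empty, map_one]
  | insert t T ht ih =>
    rw [Finset.mem_insert, not_or] at hj
    rw [yProd_insert_of_lt ht, map_mul, ih hj.2]
    congr 1
    by_cases h : t < n
    · rw [show t = ((⟨t, h⟩ : Fin n) : ℕ) from rfl, eAct_yV, sum_transvection_smul,
        if_neg fun h' => hj.1 (congrArg Fin.val h').symm, add_zero]
    · rw [yV, dif_neg h, map_zero]

/-- The sign in the action of a transvection on `y_T`. -/
def transvectionSign (F : Type) [Field F] (a j : ℕ) (T : Finset ℕ) : F :=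
  (-1) ^ (#{t ∈ T.erase j | t < j} + #{t ∈ T.erase j | t < a})

theorem eAct_transvection_yProd (a j : Fin n) (T : Finset ℕ) :
    eAct F n (Matrix.transvection a j 1) (yProd F n T) = yProd F n T +
      if (j : ℕ) ∈ T ∧ (a : ℕ) ∉ T.erase j then
        transvectionSign F a j T • yProd F n (insert (a : ℕ) (T.erase j)) else 0 := by
  by_cases hj : (j : ℕ) ∈ T
  · have hsq : ∀ k : ℕ, (-1 : F) ^ k * (-1) ^ k = 1 := fun k => by rw [← mul_pow]; simp
    have h1 := yV_mul_yProd_of_notMem (F := F) (n := n) (Finset.notMem_erase (j : ℕ) T)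
    rw [Finset.insert_erase hj] at h1
    have h2 : yProd F n T = (-1 : F) ^ #{t ∈ T.erase (j : ℕ) | t < (j : ℕ)} •
        (yV F n j * yProd F n (T.erase j)) := by
      rw [h1, smul_smul, hsq, one_smul]
    have h3 : eAct F n (Matrix.transvection a j 1) (yProd F n T) = yProd F n T +
        (-1 : F) ^ #{t ∈ T.erase (j : ℕ) | t < (j : ℕ)} • (yV F n a * yProd F n (T.erase j)) := by
      conv_lhs => rw [h2]
      rw [map_smul, map_mul, eAct_transvection_yProd_of_notMem (Finset.notMem_erase _ _), eAct_yV,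
        sum_transvection_smul, if_pos rfl, add_mul, smul_add, ← h2]
    rw [h3]
    congr 1
    split_ifs with h
    · rw [yV_mul_yProd_of_notMem h.2, smul_smul, ← pow_add, transvectionSign]
    · rw [yV_mul_yProd_of_mem (not_not.1 fun h' => h ⟨hj, h'⟩), smul_zero]
  · rw [if_neg fun h => hj h.1, add_zero, eAct_transvection_yProd_of_notMem hj]

theorem X_dvd_gAct_transvection_sub (a j : Fin n) (s : SV F n) :
    X a ∣ gAct F n (Matrix.transvection a j 1) s - s := by
  induction s using MvPolynomial.induction_on with
  | C c => rw [← MvPolynomial.algebraMap_eq, AlgHom.commutes, sub_self]; exact dvd_zero _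
  | add s t hs ht => rw [map_add, add_sub_add_comm]; exact dvd_add hs ht
  | mul_X s i hs =>
    have hX : X a ∣ gAct F n (Matrix.transvection a j 1) (X i) - X i := by
      rw [gAct_X, sum_transvection_smul, add_sub_cancel_left]
      split_ifs
      · exact dvd_rfl
      · exact dvd_zero _
    rw [map_mul, show ∀ p q r t : SV F n, p * q - r * t = p * (q - t) + (p - r) * t by
      intros; ring]
    exact dvd_add (hX.mul_left _) (hs.mul_right _)

theorem tAct_sum_smul_yProd (g : Matrix (Fin n) (Fin n) F) (c : Finset ℕ → SV F n) :
    tAct F n g (∑ T ∈ (range n).powerset, c T • (1 ⊗ₜ[F] yProd F n T : SL F n)) =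
      ∑ T ∈ (range n).powerset, gAct F n g (c T) • (1 ⊗ₜ[F] eAct F n g (yProd F n T) : SL F n) := by
  rw [map_sum]
  refine Finset.sum_congr rfl fun T _ => ?_
  rw [TensorProduct.smul_tmul', TensorProduct.smul_tmul', smul_eq_mul, smul_eq_mul, mul_one,
    mul_one, tAct, Algebra.TensorProduct.map_tmul]

/-- A coefficient of an `SL_n`-invariant at `y_S` is divisible by `x_a` for every `a ∉ S`. -/
theorem X_dvd_coeff {c : Finset ℕ → SV F n}
    (hf : ∀ g ∈ SLset F n, tAct F n g
      (∑ T ∈ (range n).powerset, c T • (1 ⊗ₜ[F] yProd F n T : SL F n)) =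
        ∑ T ∈ (range n).powerset, c T • (1 ⊗ₜ[F] yProd F n T : SL F n))
    {S : Finset ℕ} (hS : S ⊆ range n) (hne : S.Nonempty) {a : Fin n} (ha : (a : ℕ) ∉ S) :
    X a ∣ c S := by
  obtain ⟨j', hj'⟩ := hne
  obtain ⟨j, rfl⟩ : ∃ j : Fin n, (j : ℕ) = j' := ⟨⟨j', Finset.mem_range.1 (hS hj')⟩, rfl⟩
  have haj : a ≠ j := fun h => ha (h ▸ hj')
  set g := Matrix.transvection a j (1 : F) with hg
  set s : Finset ℕ → F := transvectionSign F a j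
  have hinv := hf g (Matrix.det_transvection_of_ne a j haj 1)
  have hre : ∑ T ∈ (range n).powerset, (if (j : ℕ) ∈ T ∧ (a : ℕ) ∉ T.erase j then
        (s T • gAct F n g (c T)) • (1 ⊗ₜ[F] yProd F n (insert (a : ℕ) (T.erase j)) : SL F n) else 0) =
      ∑ U ∈ (range n).powerset, (if (a : ℕ) ∈ U ∧ (j : ℕ) ∉ U then
        s (insert (j : ℕ) (U.erase a)) • gAct F n g (c (insert (j : ℕ) (U.erase a))) else 0) •
          (1 ⊗ₜ[F] yProd F n U : SL F n) := by
    simp_rw [ite_smul, zero_smul]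
    rw [← Finset.sum_filter, ← Finset.sum_filter]
    have haj' : (a : ℕ) ≠ j := fun h => haj (Fin.ext h)
    refine Finset.sum_nbij' (fun T => insert (a : ℕ) (T.erase j))
      (fun U => insert (j : ℕ) (U.erase a)) ?_ ?_ ?_ ?_ ?_
    · intro T hT
      simp only [Finset.mem_filter, Finset.mem_powerset, Finset.mem_erase, not_and,
        Finset.mem_insert, true_or, true_and, not_or] at hT ⊢
      exact ⟨Finset.insert_subset (Finset.mem_range.2 a.2)
        ((Finset.erase_subset _ _).trans hT.1), haj'.symm, fun h => absurd rfl h⟩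
    · intro U hU
      simp only [Finset.mem_filter, Finset.mem_powerset] at hU ⊢
      refine ⟨Finset.insert_subset (Finset.mem_range.2 j.2)
        ((Finset.erase_subset _ _).trans hU.1), Finset.mem_insert_self _ _, ?_⟩
      simp [haj']
    · intro T hT
      simp only [Finset.mem_filter] at hT
      rw [Finset.erase_insert hT.2.2, Finset.insert_erase hT.2.1]
    · intro U hU
      simp only [Finset.mem_filter] at hU
      rw [Finset.erase_insert (by simp [hU.2.2]), Finset.insert_erase hU.2.1]
    · intro T hT
      simp only [Finset.mem_filter] at hT
      rw [Finset.erase_insert hT.2.2, Finset.insert_erase hT.2.1]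
  have hsum : ∑ U ∈ (range n).powerset, (gAct F n g (c U) + if (a : ℕ) ∈ U ∧ (j : ℕ) ∉ U then
        s (insert (j : ℕ) (U.erase a)) • gAct F n g (c (insert (j : ℕ) (U.erase a))) else 0) •
          (1 ⊗ₜ[F] yProd F n U : SL F n) =
      ∑ T ∈ (range n).powerset, c T • (1 ⊗ₜ[F] yProd F n T : SL F n) := by
    refine Eq.trans ?_ hinv
    simp_rw [add_smul]
    rw [tAct_sum_smul_yProd, Finset.sum_add_distrib, ← hre, ← Finset.sum_add_distrib]
    refine Finset.sum_congr rfl fun T _ => ?_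
    rw [eAct_transvection_yProd, TensorProduct.tmul_add, smul_add]
    congr 1
    split_ifs
    · rw [TensorProduct.tmul_smul, smul_comm, smul_assoc]
    · rw [TensorProduct.tmul_zero, smul_zero]
  have haS : (a : ℕ) ∉ S.erase j := fun h => ha (Finset.mem_of_mem_erase h)
  have hcoeff := eq_of_sum_smul_yProd_eq hsum (T := insert (a : ℕ) (S.erase j))
    (Finset.insert_subset (Finset.mem_range.2 a.2) ((Finset.erase_subset _ _).trans hS))
  rw [if_pos ⟨Finset.mem_insert_self _ _, by
      simpa using fun h : (j : ℕ) = a => haj (Fin.ext h.symm)⟩,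
    Finset.erase_insert haS, Finset.insert_erase hj'] at hcoeff
  have h1 : X a ∣ s S • gAct F n g (c S) := by
    rw [eq_sub_of_add_eq' hcoeff, ← neg_sub]
    exact (X_dvd_gAct_transvection_sub a j _).neg_right
  have h2 : X a ∣ gAct F n g (c S) := by
    have hsq : s S * s S = 1 := by
      simp only [s, transvectionSign]
      rw [← mul_pow]
      simp
    rw [← one_smul F (gAct F n g (c S)), ← hsq, mul_smul]
    exact dvd_smul_of_dvd _ h1
  exact (dvd_iff_dvd_of_dvd_sub (X_dvd_gAct_transvection_sub a j _)).1 h2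

theorem X_dvd_minorDet {q : ℕ} (hq : q ≠ 0) {B T : Finset ℕ} {a : Fin n} (ha : (a : ℕ) ∈ T) :
    X a ∣ minorDet (mooreEntry F q n) B T := by
  rw [minorDet]
  split_ifs with h
  · obtain ⟨j, hj⟩ : ∃ j, T.orderEmbOfFin h j = a := by
      rw [← Set.mem_range, Finset.range_orderEmbOfFin]
      exact ha
    rw [Matrix.det_apply]
    refine Finset.dvd_sum fun σ _ => ?_
    rw [Units.smul_def, zsmul_eq_mul]
    refine Dvd.dvd.mul_left (Dvd.dvd.trans ?_ (Finset.dvd_prod_of_mem _ (Finset.mem_univ j))) _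
    rw [Matrix.of_apply, hj, mooreEntry, xV_fin]
    exact dvd_pow_self _ (pow_ne_zero _ hq)
  · exact dvd_zero _

theorem substY_sum_smul_yProd (w : ℕ → ℕ → SV F n) (c : Finset ℕ → SV F n) :
    substY w (∑ T ∈ (range n).powerset, c T • (1 ⊗ₜ[F] yProd F n T : SL F n)) =
      ∑ B ∈ (range n).powerset, (∑ T ∈ (range n).powerset, c T * minorDet w B T) •
        (1 ⊗ₜ[F] yProd F n B : SL F n) := by
  rw [map_sum]
  simp_rw [Finset.sum_smul]
  rw [Finset.sum_comm]
  refine Finset.sum_congr rfl fun T hT => ?_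
  rw [map_smul, substY_yProd w (Finset.mem_powerset.1 hT), Finset.smul_sum]
  simp_rw [smul_smul]
  refine Finset.sum_subset (fun B hB => Finset.mem_powerset.2 (Finset.mem_powersetCard.1 hB).1)
    fun B hB h => ?_
  rw [minorDet, dif_neg fun hTB => h (Finset.mem_powersetCard.2
    ⟨Finset.mem_powerset.1 hB, hTB.symm⟩), mul_zero, zero_smul]

/-- The nonconstant coefficients of the image of an invariant under the Moore substitution are
divisible by every variable. -/
theorem X_dvd_coeff_substY {q : ℕ} (hq : q ≠ 0) {f : SL F n} (hf : f ∈ invSL F n (SLset F n))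
    {b : Finset ℕ → SV F n} (hb : substY (mooreEntry F q n) f =
      ∑ B ∈ (range n).powerset, b B • (1 ⊗ₜ[F] yProd F n B : SL F n))
    {B : Finset ℕ} (hB : B ⊆ range n) (hne : B.Nonempty) (a : Fin n) : X a ∣ b B := by
  obtain ⟨c, rfl⟩ := exists_eq_sum_smul_yProd f
  rw [substY_sum_smul_yProd] at hb
  rw [← eq_of_sum_smul_yProd_eq hb hB]
  refine Finset.dvd_sum fun T hT => ?_
  by_cases ha : (a : ℕ) ∈ T
  · exact (X_dvd_minorDet hq ha).mul_left _
  rcases T.eq_empty_or_nonempty with rfl | hT0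
  · rw [minorDet, dif_neg (by rw [Finset.card_empty]; exact hne.card_pos.ne), mul_zero]
    exact dvd_zero _
  · exact (X_dvd_coeff hf (Finset.mem_powerset.1 hT) hT0 ha).mul_right _

theorem gAct_gAct (g h : Matrix (Fin n) (Fin n) F) (s : SV F n) :
    gAct F n g (gAct F n h s) = gAct F n (g * h) s := by
  have : (gAct F n g).comp (gAct F n h) = gAct F n (g * h) := by
    refine MvPolynomial.algHom_ext fun j => ?_
    rw [AlgHom.comp_apply, gAct_X, gAct_X, map_sum]
    simp_rw [map_smul, gAct_X, Finset.smul_sum, smul_smul, Matrix.mul_apply, Finset.sum_smul]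
    rw [Finset.sum_comm]
    exact Finset.sum_congr rfl fun i _ => Finset.sum_congr rfl fun k _ => by rw [mul_comm]
  exact DFunLike.congr_fun this s

theorem gAct_one (s : SV F n) : gAct F n 1 s = s := by
  have : gAct F n 1 = AlgHom.id F (SV F n) := by
    refine MvPolynomial.algHom_ext fun j => ?_
    rw [gAct_X, AlgHom.id_apply]
    simp [Matrix.one_apply]
  exact DFunLike.congr_fun this s

theorem irreducible_gAct_X {g : Matrix (Fin n) (Fin n) F} (hg : g.det = 1) (a : Fin n) :
    Irreducible (gAct F n g (X a)) := by
  have hu : IsUnit g.det := hg ▸ isUnit_one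
  let e : SV F n ≃ₐ[F] SV F n := AlgEquiv.ofAlgHom (gAct F n g) (gAct F n g⁻¹)
    (AlgHom.ext fun s => by
      rw [AlgHom.comp_apply, gAct_gAct, Matrix.mul_nonsing_inv _ hu, gAct_one, AlgHom.id_apply])
    (AlgHom.ext fun s => by
      rw [AlgHom.comp_apply, gAct_gAct, Matrix.nonsing_inv_mul _ hu, gAct_one, AlgHom.id_apply])
  exact (MulEquiv.irreducible_iff e.toMulEquiv).2 MvPolynomial.X_prime.irreducible

/-- The linear factors of `L_n`. -/
def linForm (F : Type) [Field F] (n a : ℕ) (c : Fin a → F) : SV F n :=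
  (∑ k : Fin a, MvPolynomial.C (c k) * xV F n k) + xV F n a

theorem exists_gAct_X_eq_linForm (a : Fin n) (c : Fin a → F) :
    ∃ g : Matrix (Fin n) (Fin n) F, g.det = 1 ∧ gAct F n g (X a) = linForm F n a c := by
  let v : Fin n → F := fun i =>
    if h : (i : ℕ) < a then c ⟨i, h⟩ else if i = a then 1 else 0
  refine ⟨(1 : Matrix (Fin n) (Fin n) F).updateCol a v, ?_, ?_⟩
  · rw [← Matrix.cramer_apply, Matrix.cramer_one]
    simp [v]
  · have hsum : ∑ k : Fin a, MvPolynomial.C (c k) * xV F n k =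
        ∑ i : Fin n, if h : (i : ℕ) < a then c ⟨i, h⟩ • (X i : SV F n) else 0 := by
      refine Finset.sum_of_injOn (Fin.castLE a.2.le) (Fin.castLE_injective _).injOn
        (fun _ _ => Finset.mem_coe.2 (Finset.mem_univ _)) ?_ ?_
      · intro i _ hi
        rw [dif_neg]
        exact fun h => hi ⟨⟨i, h⟩, Finset.mem_coe.2 (Finset.mem_univ _), rfl⟩
      · intro k _
        rw [dif_pos (show ((Fin.castLE a.2.le k : Fin n) : ℕ) < a from k.2),
          ← MvPolynomial.smul_eq_C_mul, xV_of_lt (k.2.trans a.2)]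
        rfl
    have hX : (X a : SV F n) = ∑ i, if i = a then X i else 0 := by simp
    rw [gAct_X, linForm, hsum, xV_fin]
    conv_rhs => rw [hX]
    rw [← Finset.sum_add_distrib]
    refine Finset.sum_congr rfl fun i _ => ?_
    rw [Matrix.updateCol_self]
    by_cases h : (i : ℕ) < a
    · rw [dif_pos h, if_neg fun h' : i = a => h.ne (congrArg Fin.val h'), add_zero]
      simp only [v, dif_pos h]
    · by_cases hia : i = a
      · simp [v, hia]
      · rw [dif_neg h, if_neg hia, add_zero]
        simp only [v, dif_neg h, if_neg hia, zero_smul]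

theorem aeval_linForm (a : Fin n) (c : Fin a → F) (v : Fin n → F) :
    MvPolynomial.aeval v (linForm F n a c) = (∑ k, c k * v (Fin.castLE a.2.le k)) + v a := by
  rw [linForm, xV_fin, map_add, map_sum, MvPolynomial.aeval_X]
  congr 1
  refine Finset.sum_congr rfl fun k _ => ?_
  rw [map_mul, MvPolynomial.aeval_C, xV_of_lt (k.2.trans a.2), MvPolynomial.aeval_X]
  rfl

theorem isRelPrime_linForm {s t : (a : Fin n) × (Fin a → F)} (hst : s ≠ t) :
    IsRelPrime (linForm F n s.1 s.2) (linForm F n t.1 t.2) := by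
  wlog hle : s.1 ≤ t.1 generalizing s t
  · exact (this hst.symm (le_of_not_ge hle)).symm
  obtain ⟨a, c⟩ := s
  obtain ⟨b, d⟩ := t
  obtain ⟨g, hg, hgX⟩ := exists_gAct_X_eq_linForm a c
  have hirr : Irreducible (linForm F n a c) := hgX ▸ irreducible_gAct_X hg a
  refine hirr.isRelPrime_iff_not_dvd.2 fun hdvd => ?_
  suffices ∃ v : Fin n → F, MvPolynomial.aeval v (linForm F n a c) = 0 ∧
      MvPolynomial.aeval v (linForm F n b d) ≠ 0 by
    obtain ⟨v, h0, h1⟩ := this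
    exact h1 (zero_dvd_iff.1 (h0 ▸ map_dvd (MvPolynomial.aeval v) hdvd))
  simp only [aeval_linForm]
  have hne : ∀ {e : Fin n} (k : Fin e), Fin.castLE e.2.le k ≠ e := fun k h =>
    k.2.ne (congrArg Fin.val h)
  rcases (show a ≤ b from hle).lt_or_eq with hab | rfl
  · refine ⟨Pi.single b 1, ?_, ?_⟩
    · rw [Pi.single_eq_of_ne hab.ne, add_zero]
      refine Finset.sum_eq_zero fun k _ => ?_
      rw [Pi.single_eq_of_ne, mul_zero]
      exact fun h => (k.2.trans hab).ne (congrArg Fin.val h)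
    · simp [Pi.single_eq_of_ne (hne _)]
  · obtain ⟨k, hk⟩ : ∃ k, c k ≠ d k := by
      by_contra! h
      exact hst (by rw [funext h])
    have hval : ∀ e : Fin a → F, (∑ i, e i * (Pi.single (Fin.castLE a.2.le k) 1 -
        c k • Pi.single a 1 : Fin n → F) (Fin.castLE a.2.le i)) +
          (Pi.single (Fin.castLE a.2.le k) 1 - c k • Pi.single a 1 : Fin n → F) a =
            e k - c k := by
      intro e
      simp [Pi.single_apply, hne, (hne _).symm, sub_eq_add_neg]
    exact ⟨_, (hval c).trans (sub_self _), by rw [hval d]; exact sub_ne_zero.2 hk.symm⟩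

theorem Lm_eq_prod_linForm [Fintype F] :
    Lm F n n = ∏ s : (a : Fin n) × (Fin a → F), linForm F n s.1 s.2 := by
  rw [Fintype.prod_sigma, Lm, Finset.prod_range]
  rfl

theorem Lm_dvd_coeff_substY [Fintype F] {q : ℕ} (hF : Fintype.card F = q) {f : SL F n}
    (hf : f ∈ invSL F n (SLset F n)) {b : Finset ℕ → SV F n}
    (hb : substY (mooreEntry F q n) f =
      ∑ B ∈ (range n).powerset, b B • (1 ⊗ₜ[F] yProd F n B : SL F n))
    {B : Finset ℕ} (hB : B ⊆ range n) (hne : B.Nonempty) : Lm F n n ∣ b B := by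
  rw [Lm_eq_prod_linForm]
  refine Fintype.prod_dvd_of_isRelPrime (fun _ _ => isRelPrime_linForm) fun s => ?_
  obtain ⟨g, hg, hgX⟩ := exists_gAct_X_eq_linForm s.1 s.2
  rw [← hgX, ← gAct_coeff_eq hF (hf g hg) hb hB]
  exact map_dvd _ (X_dvd_coeff_substY (hF ▸ Fintype.card_ne_zero) hf hb hB hne s.1)

end Divisibility

section Basis

variable {F : Type} [Field F] {n : ℕ}

/-- The sign with which the Moore substitution sends `M_{n;B}` to `L_n y_B`. -/
def muiSign (F : Type) [Field F] (n : ℕ) (B : Finset ℕ) : SV F n :=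
  (-1) ^ (#B * (#B + 1) / 2 + ∑ b ∈ B, b + #B)

theorem muiSign_mul_self (B : Finset ℕ) : muiSign F n B * muiSign F n B = 1 := by
  rw [muiSign, ← mul_pow]
  simp

theorem muiSign_mem (R : Subalgebra F (SV F n)) (B : Finset ℕ) : muiSign F n B ∈ R :=
  pow_mem (neg_mem (one_mem R)) _

variable [Fintype F] {q : ℕ} {Q : (m : ℕ) → ℕ → SV F m}

theorem adjoin_Lm_dickson_eq (hF : Fintype.card F = q) (hQ : DicksonProp F q Q) :
    Algebra.adjoin F (insert (Lm F n n) ((fun k => Q n k) '' Set.Icc 1 (n - 1))) =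
      dicksonAlg n Q := by
  apply le_antisymm
  · refine Algebra.adjoin_le (Set.insert_subset Lm_mem_dicksonAlg ?_)
    rintro _ ⟨k, hk, rfl⟩
    exact dickson_mem_dicksonAlg hF hQ (hk.2.trans (Nat.sub_le n 1))
  · refine Algebra.adjoin_mono ?_
    rintro _ ⟨k, rfl⟩
    rw [dicksonGen]
    split_ifs with h
    · exact Set.mem_insert _ _
    · exact Set.mem_insert_of_mem _ ⟨k, ⟨Nat.pos_of_ne_zero h, by omega⟩, rfl⟩

theorem substY_mui_combination (hF : Fintype.card F = q) (c₀ : SV F n)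
    (c : Finset ℕ → SV F n) :
    substY (mooreEntry F q n) (c₀ ⊗ₜ[F] 1 +
      ∑ B ∈ (range n).powerset with B.Nonempty, (c B ⊗ₜ[F] 1) * MuiM F q n n B) =
    ∑ B ∈ (range n).powerset, (if B.Nonempty then c B * (muiSign F n B * Lm F n n) else c₀) •
      (1 ⊗ₜ[F] yProd F n B : SL F n) := by
  have hs : ∀ s : SV F n, (s ⊗ₜ[F] 1 : SL F n) = algebraMap (SV F n) (SL F n) s := fun _ => rfl
  rw [← Finset.sum_filter_add_sum_filter_not (range n).powerset (fun B => B.Nonempty), map_add,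
    map_sum, add_comm]
  congr 1
  · refine Finset.sum_congr rfl fun B hB => ?_
    rw [Finset.mem_filter, Finset.mem_powerset] at hB
    rw [if_pos hB.2, hs, ← Algebra.smul_def, map_smul, substY_MuiM q hB.1, smul_smul,
      subDet_range_range hF, muiSign]
  · have : (range n).powerset.filter (fun B => ¬ B.Nonempty) = {∅} := by
      ext B
      simp only [Finset.mem_filter, Finset.mem_powerset, Finset.not_nonempty_iff_eq_empty,
        Finset.mem_singleton, and_iff_right_iff_imp]
      rintro rfl
      exact Finset.empty_subset _
    rw [this, Finset.sum_singleton, if_neg Finset.not_nonempty_empty, yProd_empty, hs,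
      AlgHom.commutes, Algebra.algebraMap_eq_smul_one, Algebra.TensorProduct.one_def]

theorem mui_combination_mem_invSL (hF : Fintype.card F = q) {c₀ : SV F n}
    {c : Finset ℕ → SV F n} (hc₀ : c₀ ∈ invS F n (SLset F n))
    (hc : ∀ B ∈ (range n).powerset.filter (fun B => B.Nonempty), c B ∈ invS F n (SLset F n)) :
    c₀ ⊗ₜ[F] 1 + ∑ B ∈ (range n).powerset with B.Nonempty, (c B ⊗ₜ[F] 1) * MuiM F q n n B ∈
      invSL F n (SLset F n) := by
  intro g hg
  have hs : ∀ {s : SV F n}, s ∈ invS F n (SLset F n) →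
      tAct F n g (s ⊗ₜ[F] 1) = s ⊗ₜ[F] 1 := fun {s} h => by
    rw [tAct, Algebra.TensorProduct.map_tmul, map_one, h g hg]
  rw [map_add, map_sum, hs hc₀]
  congr 1
  refine Finset.sum_congr rfl fun B hB => ?_
  rw [map_mul, hs (hc B hB), tAct_MuiM hF ((subDet_range_range hF).trans_ne Lm_ne_zero) hg
    (Finset.mem_powerset.1 (Finset.mem_filter.1 hB).1)]

theorem exists_mui_combination (hF : Fintype.card F = q) {f : SL F n}
    (hf : f ∈ invSL F n (SLset F n)) :
    ∃ c₀ : SV F n, ∃ c : Finset ℕ → SV F n, c₀ ∈ invS F n (SLset F n) ∧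
      (∀ B ∈ (range n).powerset.filter (fun B => B.Nonempty), c B ∈ invS F n (SLset F n)) ∧
      f = c₀ ⊗ₜ[F] 1 +
        ∑ B ∈ (range n).powerset with B.Nonempty, (c B ⊗ₜ[F] 1) * MuiM F q n n B := by
  obtain ⟨b, hb⟩ := exists_eq_sum_smul_yProd (substY (mooreEntry F q n) f)
  have hdvd : ∀ B : Finset ℕ, ∃ h : SV F n,
      B ∈ (range n).powerset.filter (fun B => B.Nonempty) → b B = Lm F n n * h := by
    intro B
    by_cases hB : B ∈ (range n).powerset.filter (fun B => B.Nonempty)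
    · have hB' := Finset.mem_filter.1 hB
      obtain ⟨h, hh⟩ := Lm_dvd_coeff_substY hF hf hb (Finset.mem_powerset.1 hB'.1) hB'.2
      exact ⟨h, fun _ => hh⟩
    · exact ⟨0, fun h => absurd h hB⟩
  choose h hh using hdvd
  refine ⟨b ∅, fun B => h B * muiSign F n B, fun g hg => ?_, fun B hB => ?_, ?_⟩
  · exact gAct_coeff_eq hF (hf g hg) hb (Finset.empty_subset _)
  · refine mul_mem (fun g hg => ?_) (muiSign_mem _ B)
    have hg' := gAct_coeff_eq hF (hf g hg) hb
      (Finset.mem_powerset.1 (Finset.mem_filter.1 hB).1)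
    rw [hh B hB, map_mul, gAct_Lm hF, show g.det = 1 from hg, map_one, one_mul] at hg'
    exact mul_left_cancel₀ Lm_ne_zero hg'
  · refine substY_injective (mooreEntry F q n) ?_ ?_
    · rw [← subDet_eq_minorDet, subDet_range_range hF]
      exact Lm_ne_zero
    · rw [hb, substY_mui_combination hF]
      refine Finset.sum_congr rfl fun B hB => ?_
      congr 1
      split_ifs with hne
      · rw [hh B (Finset.mem_filter.2 ⟨hB, hne⟩), mul_assoc, ← mul_assoc (muiSign F n B),
          muiSign_mul_self, one_mul, mul_comm]
      · rw [Finset.not_nonempty_iff_eq_empty.1 hne]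

theorem eq_zero_of_mui_combination_eq_zero (hF : Fintype.card F = q) {c₀ : SV F n}
    {c : Finset ℕ → SV F n} (h : c₀ ⊗ₜ[F] 1 +
      ∑ B ∈ (range n).powerset with B.Nonempty, (c B ⊗ₜ[F] 1) * MuiM F q n n B = 0) :
    c₀ = 0 ∧ ∀ B ∈ (range n).powerset.filter (fun B => B.Nonempty), c B = 0 := by
  have h' := (substY_mui_combination hF c₀ c).symm.trans ((congrArg _ h).trans (map_zero _))
  constructor
  · simpa using eq_zero_of_sum_smul_yProd_eq_zero h' (Finset.empty_subset _)
  · intro B hB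
    have hB' := Finset.mem_filter.1 hB
    have hz := eq_zero_of_sum_smul_yProd_eq_zero h' (Finset.mem_powerset.1 hB'.1)
    rw [if_pos hB'.2] at hz
    exact (mul_eq_zero.1 hz).resolve_right
      (mul_ne_zero (left_ne_zero_of_mul_eq_one (muiSign_mul_self B)) Lm_ne_zero)

end Basis

/-- **Mui's theorem for `SL_n(q)`** (Theorem 2.5, first part). With
`R = F_q[L_n, Q_{n,1}, …, Q_{n,n−1}]`, the invariants `(S(V) ⊗ Λ(V))^{SL_n(q)}`
form a free `R`-module with basis `1` together with the `M_{n;b_1,…,b_j}`,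
`1 ≤ j ≤ n`, `0 ≤ b_1 < ⋯ < b_j ≤ n−1`; in particular
`S(V)^{SL_n(q)} = F_q[L_n, Q_{n,1}, …, Q_{n,n−1}]`. -/
theorem mui_SL_invariants
    (F : Type) [Field F] [Fintype F] (p r q n : ℕ)
    (hp : p.Prime) (hr : 0 < r) (hq : q = p ^ r) (hF : Fintype.card F = q)
    (Q : (m : ℕ) → ℕ → SV F m) (hQ : DicksonProp F q Q) :
    let R : Subalgebra F (SV F n) :=
      Algebra.adjoin F (insert (Lm F n n) ((fun k => Q n k) '' Set.Icc 1 (n - 1)))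
    let idx : Finset (Finset ℕ) := (range n).powerset.filter (fun B => B.Nonempty)
    (invS F n (SLset F n) = R)
    ∧ (∀ f : SL F n, f ∈ invSL F n (SLset F n) ↔
        ∃ c₀ : SV F n, ∃ c : Finset ℕ → SV F n,
          c₀ ∈ R ∧ (∀ B ∈ idx, c B ∈ R) ∧
          f = c₀ ⊗ₜ[F] 1 + ∑ B ∈ idx, (c B ⊗ₜ[F] 1) * MuiM F q n n B)
    ∧ (∀ c₀ : SV F n, ∀ c : Finset ℕ → SV F n,
        c₀ ∈ R → (∀ B ∈ idx, c B ∈ R) →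
        c₀ ⊗ₜ[F] 1 + ∑ B ∈ idx, (c B ⊗ₜ[F] 1) * MuiM F q n n B = 0 →
        c₀ = 0 ∧ ∀ B ∈ idx, c B = 0) := by
  intro R idx
  have hR : invS F n (SLset F n) = R :=
    (le_antisymm (invS_le_dicksonAlg hF hQ) (dicksonAlg_le_invS hF hQ)).trans
      (adjoin_Lm_dickson_eq hF hQ).symm
  refine ⟨hR, fun f => ⟨fun hf => ?_, ?_⟩, fun c₀ c _ _ h =>
    eq_zero_of_mui_combination_eq_zero hF h⟩
  · rw [← hR]
    exact exists_mui_combination hF hf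
  · rintro ⟨c₀, c, hc₀, hc, rfl⟩
    rw [← hR] at hc₀ hc
    exact mui_combination_mem_invSL hF hc₀ hc
end
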